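/- arXiv:2310.09128 — 4 statements merged into one kernel-verified Lean document; each statement's English description precedes it below -/
import Mathlib

section
/- For every graph G in G_9 and every vertex v of G, there exists a vertex v' ∈ V(G) \ {v} such that the subgraph of G induced by V(G) \ ({v} ∪ N[v']) is isomorphic to P_3 (the path on 3 vertices) or to K_3 (the triangle). -/
open SimpleGraph

/-- The closed neighbourhood `N[D]` of a set `D` of vertices of `G`. -/
def closedNbhd {V : Type*} (G : SimpleGraph V) (D : Set V) : Set V :=
  D ∪ {v | ∃ u ∈ D, G.Adj u v}

/-- `G` contains a subgraph isomorphic to `H` (a copy of `H`). -/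
def HasCopy {W V : Type*} (H : SimpleGraph W) (G : SimpleGraph V) : Prop :=
  ∃ f : W ↪ V, ∀ ⦃a b⦄, H.Adj a b → G.Adj (f a) (f b)

/-- `D` is an `H`-isolating set of `G` (single graph `H`). -/
def IsIsolating {W V : Type*} (H : SimpleGraph W) (G : SimpleGraph V) (D : Set V) : Prop :=
  ¬ HasCopy H (G.induce (closedNbhd G D)ᶜ)

/-- The `H`-isolation number of `G` (single graph `H`). -/
noncomputable def isolNum {W V : Type*} (H : SimpleGraph W) (G : SimpleGraph V) : ℕ :=
  sInf {k | ∃ D : Set V, D.ncard = k ∧ IsIsolating H G D}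

/-- `D` is an `F`-isolating set of `G`, for a set `F` of graphs. -/
def IsIsolatingFam {V : Type*} (F : Set ((n : ℕ) × SimpleGraph (Fin n)))
    (G : SimpleGraph V) (D : Set V) : Prop :=
  ∀ H ∈ F, ¬ HasCopy H.2 (G.induce (closedNbhd G D)ᶜ)

/-- The `F`-isolation number of `G`, for a set `F` of graphs. -/
noncomputable def isolNumFam {V : Type*} (F : Set ((n : ℕ) × SimpleGraph (Fin n)))
    (G : SimpleGraph V) : ℕ :=
  sInf {k | ∃ D : Set V, D.ncard = k ∧ IsIsolatingFam F G D}

/-- The 4-cycle. -/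
def C4 : SimpleGraph (Fin 4) := cycleGraph 4

/-- The diamond graph: a 4-cycle together with a chord. -/
def diamondGraph : SimpleGraph (Fin 4) :=
  fromEdgeSet {s(0, 1), s(1, 2), s(2, 3), s(3, 0), s(0, 2)}

/-- The complete graph on 4 vertices. -/
def K4 : SimpleGraph (Fin 4) := ⊤

/-- `G₁`: the square of the 9-cycle. -/
def Gr1 : SimpleGraph (Fin 9) :=
  fromEdgeSet {s(0, 1), s(1, 2), s(2, 3), s(3, 4), s(4, 5), s(5, 6), s(6, 7), s(7, 8), s(8, 0),
    s(0, 2), s(1, 3), s(2, 4), s(3, 5), s(4, 6), s(5, 7), s(6, 8), s(7, 0), s(8, 1)}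

/-- `G₂`. -/
def Gr2 : SimpleGraph (Fin 9) :=
  fromEdgeSet {s(0, 1), s(0, 5), s(0, 6), s(0, 8), s(1, 2), s(1, 7), s(1, 8), s(2, 3), s(2, 6),
    s(2, 7), s(3, 4), s(3, 6), s(3, 8), s(4, 5), s(4, 7), s(4, 8), s(5, 6), s(5, 7)}

/-- `G₃`. -/
def Gr3 : SimpleGraph (Fin 9) :=
  fromEdgeSet {s(0, 1), s(0, 5), s(0, 6), s(0, 8), s(1, 2), s(1, 7), s(1, 8), s(2, 3), s(2, 7),
    s(2, 8), s(3, 4), s(3, 6), s(3, 8), s(4, 5), s(4, 6), s(4, 7), s(5, 6), s(5, 7)}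

/-- `G₄`. -/
def Gr4 : SimpleGraph (Fin 9) :=
  fromEdgeSet {s(0, 1), s(0, 2), s(0, 3), s(0, 4), s(1, 2), s(1, 5), s(1, 6), s(2, 5), s(2, 6),
    s(3, 4), s(3, 7), s(3, 8), s(4, 7), s(4, 8), s(5, 6), s(5, 8), s(6, 7), s(7, 8)}

/-- `G₅`: `G₄` with the edge `{2,3}` removed. -/
def Gr5 : SimpleGraph (Fin 9) :=
  fromEdgeSet {s(0, 1), s(0, 2), s(0, 3), s(0, 4), s(1, 5), s(1, 6), s(2, 5), s(2, 6),
    s(3, 4), s(3, 7), s(3, 8), s(4, 7), s(4, 8), s(5, 6), s(5, 8), s(6, 7), s(7, 8)}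

/-- `G₆`: `G₅` with the edge `{4,5}` removed. -/
def Gr6 : SimpleGraph (Fin 9) :=
  fromEdgeSet {s(0, 1), s(0, 2), s(0, 3), s(0, 4), s(1, 5), s(1, 6), s(2, 5), s(2, 6),
    s(3, 7), s(3, 8), s(4, 7), s(4, 8), s(5, 6), s(5, 8), s(6, 7), s(7, 8)}

/-- The set `𝒢₄ = {C₄, C₄', K₄}` of 4-vertex exceptional graphs. -/
def calG4 : Set ((n : ℕ) × SimpleGraph (Fin n)) := {⟨4, C4⟩, ⟨4, diamondGraph⟩, ⟨4, K4⟩}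

/-- The set `𝒢₉ = {G₁, …, G₆}` of 9-vertex exceptional graphs. -/
def calG9 : Set ((n : ℕ) × SimpleGraph (Fin n)) :=
  {⟨9, Gr1⟩, ⟨9, Gr2⟩, ⟨9, Gr3⟩, ⟨9, Gr4⟩, ⟨9, Gr5⟩, ⟨9, Gr6⟩}

/-- The set `ℰ₄ = 𝒢₄ ∪ 𝒢₉` of exceptional graphs. -/
def calE4 : Set ((n : ℕ) × SimpleGraph (Fin n)) := calG4 ∪ calG9

/-- If `b` is adjacent to `a` and `c`, the subgraph induced by the three vertices `a`, `b`, `c`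
is a path or a triangle. -/
theorem induce_iso_pathGraph_or_top {V : Type*} {G : SimpleGraph V} {s : Set V} {a b c : V}
    (hs : ∀ x, x ∈ s ↔ x = a ∨ x = b ∨ x = c) (hac : a ≠ c) (hab : G.Adj a b)
    (hbc : G.Adj b c) :
    Nonempty (G.induce s ≃g pathGraph 3) ∨ Nonempty (G.induce s ≃g (⊤ : SimpleGraph (Fin 3))) := by
  have hf : ∀ i : Fin 3, ![a, b, c] i ∈ s := fun i => by
    fin_cases i <;> simp [hs]
  have hbij : Function.Bijective (fun i : Fin 3 => (⟨![a, b, c] i, hf i⟩ : s)) := by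
    constructor
    · intro i j hij
      have := congrArg Subtype.val hij
      fin_cases i <;> fin_cases j <;>
        simp_all [hab.ne, hab.ne.symm, hbc.ne, hbc.ne.symm, hac.symm]
    · rintro ⟨x, hx⟩
      rcases (hs x).1 hx with rfl | rfl | rfl
      exacts [⟨0, rfl⟩, ⟨1, rfl⟩, ⟨2, rfl⟩]
  let e := Equiv.ofBijective _ hbij
  by_cases h : G.Adj a c
  · refine Or.inr ⟨(RelIso.mk e fun {i j} => ?_ : (⊤ : SimpleGraph (Fin 3)) ≃g G.induce s).symm⟩
    fin_cases i <;> fin_cases j <;> simp [e, h, h.symm, hab, hab.symm, hbc, hbc.symm]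
  · have h' : ¬ G.Adj c a := fun hca => h hca.symm
    refine Or.inl ⟨(RelIso.mk e fun {i j} => ?_ : pathGraph 3 ≃g G.induce s).symm⟩
    fin_cases i <;> fin_cases j <;>
      simp [e, h, h', hab, hab.symm, hbc, hbc.symm, pathGraph_adj]

/-- The functions `w`, `a`, `b`, `c` name, for each vertex `v`, the vertex `w v` whose closed
neighbourhood is deleted and the three vertices that remain, with `b v` in the middle. -/
theorem exists_induce_iso_of_witnesses {V : Type*} {G : SimpleGraph V} (w a b c : V → V)
    (h : ∀ v, w v ≠ v ∧ a v ≠ c v ∧ G.Adj (a v) (b v) ∧ G.Adj (b v) (c v) ∧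
      ∀ x, (x ≠ w v ∧ x ≠ v ∧ ¬ G.Adj (w v) x) ↔ (x = a v ∨ x = b v ∨ x = c v)) (v : V) :
    ∃ v' : V, v' ≠ v ∧
      (Nonempty (G.induce ({v} ∪ closedNbhd G {v'})ᶜ ≃g pathGraph 3) ∨
        Nonempty (G.induce ({v} ∪ closedNbhd G {v'})ᶜ ≃g (⊤ : SimpleGraph (Fin 3)))) := by
  obtain ⟨hw, hac, hab, hbc, hs⟩ := h v
  exact ⟨w v, hw, induce_iso_pathGraph_or_top
    (fun x => by simpa [closedNbhd, and_assoc] using hs x) hac hab hbc⟩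

set_option synthInstance.maxSize 2000 in
/-- For every `G ∈ 𝒢₉` and every vertex `v` of `G`, there is a vertex `v' ≠ v` such that the
subgraph induced by `V(G) \ ({v} ∪ N[v'])` is isomorphic to `P₃` or to `K₃`. -/
theorem stmt13 : ∀ G ∈ ({Gr1, Gr2, Gr3, Gr4, Gr5, Gr6} : Set (SimpleGraph (Fin 9))),
    ∀ v : Fin 9, ∃ v' : Fin 9, v' ≠ v ∧
      (Nonempty (G.induce ({v} ∪ closedNbhd G {v'})ᶜ ≃g pathGraph 3) ∨
        Nonempty (G.induce ({v} ∪ closedNbhd G {v'})ᶜ ≃g (⊤ : SimpleGraph (Fin 3)))) := by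
  rintro G (rfl | rfl | rfl | rfl | rfl | rfl)
  · exact exists_induce_iso_of_witnesses ![3, 4, 5, 0, 0, 0, 0, 1, 2] ![7, 7, 1, 5, 3, 3, 4, 5, 6]
      ![6, 0, 0, 4, 5, 4, 3, 4, 5] ![8, 8, 8, 6, 6, 6, 5, 6, 7]
      (by unfold Gr1; decide)
  · exact exists_induce_iso_of_witnesses ![2, 3, 0, 0, 0, 1, 1, 0, 2] ![5, 0, 3, 2, 3, 4, 3, 2, 0]
      ![4, 5, 4, 7, 2, 3, 4, 3, 5] ![8, 7, 7, 4, 7, 6, 5, 4, 4]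
      (by unfold Gr2; decide)
  · exact exists_induce_iso_of_witnesses ![2, 3, 0, 0, 0, 1, 1, 0, 4] ![5, 0, 3, 2, 3, 4, 3, 2, 0]
      ![4, 5, 4, 7, 2, 3, 4, 3, 1] ![6, 7, 7, 4, 7, 6, 5, 4, 2]
      (by unfold Gr3; decide)
  · exact exists_induce_iso_of_witnesses ![5, 3, 3, 1, 1, 0, 0, 0, 0] ![4, 5, 5, 7, 7, 6, 5, 6, 5]
      ![3, 2, 1, 4, 3, 7, 8, 5, 6] ![7, 6, 6, 8, 8, 8, 7, 8, 7]
      (by unfold Gr4; decide)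
  · exact exists_induce_iso_of_witnesses ![5, 3, 3, 5, 5, 0, 0, 0, 0] ![4, 5, 5, 0, 0, 6, 5, 6, 5]
      ![3, 2, 1, 4, 3, 7, 8, 5, 6] ![7, 6, 6, 7, 7, 8, 7, 8, 7]
      (by unfold Gr5; decide)
  · exact exists_induce_iso_of_witnesses ![5, 7, 7, 5, 5, 0, 0, 0, 0] ![3, 0, 0, 0, 0, 6, 5, 6, 5]
      ![7, 2, 1, 4, 3, 7, 8, 5, 6] ![4, 5, 5, 7, 7, 8, 7, 8, 7]
      (by unfold Gr6; decide)
end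

section
/- If G is an E_4-graph, then ι(G, C_4) > ⌊|V(G)|/5⌋. -/
open SimpleGraph

lemma C4_adj_iff (i j : Fin 4) : C4.Adj i j ↔ j = i + 1 ∨ i = j + 1 := by
  rw [C4, cycleGraph_adj]
  revert i j
  decide

lemma hasCopy_C4_of_adj_succ {V : Type*} {G : SimpleGraph V} (f : Fin 4 ↪ V)
    (hf : ∀ i, G.Adj (f i) (f (i + 1))) : HasCopy C4 G := by
  refine ⟨f, fun a b hab => ?_⟩
  rcases (C4_adj_iff a b).1 hab with rfl | rfl
  · exact hf a
  · exact (hf b).symm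

lemma HasCopy.trans_iso {U V W : Type*} {F : SimpleGraph U} {G : SimpleGraph V}
    {H : SimpleGraph W} (h : HasCopy F H) (e : H ≃g G) : HasCopy F G := by
  obtain ⟨f, hf⟩ := h
  exact ⟨f.trans e.toEquiv.toEmbedding, fun a b hab => e.map_adj_iff.2 (hf hab)⟩

lemma isIsolating_univ {V W : Type*} [Nonempty W] (F : SimpleGraph W) (G : SimpleGraph V) :
    IsIsolating F G Set.univ := by
  rintro ⟨f, -⟩
  exact (f (Classical.arbitrary W)).2 (Or.inl trivial)

lemma isIsolating_empty_iff {V W : Type*} (F : SimpleGraph W) (G : SimpleGraph V) :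
    IsIsolating F G ∅ ↔ ¬ HasCopy F G := by
  have h : ∀ v, v ∈ (closedNbhd G ∅)ᶜ := by simp [closedNbhd]
  refine not_congr ⟨?_, ?_⟩
  · rintro ⟨f, hf⟩
    exact ⟨f.trans (Function.Embedding.subtype _), fun a b hab => hf hab⟩
  · rintro ⟨f, hf⟩
    exact ⟨⟨fun a => ⟨f a, h _⟩, fun a b hab => f.injective (congrArg Subtype.val hab)⟩,
      fun a b hab => hf hab⟩

lemma lt_isolNum {V W : Type*} [Nonempty W] {F : SimpleGraph W} {G : SimpleGraph V} {k : ℕ}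
    (h : ∀ D : Set V, D.ncard ≤ k → ¬ IsIsolating F G D) : k < isolNum F G := by
  obtain ⟨D, hD, hiso⟩ := Nat.sInf_mem
    (s := {k | ∃ D : Set V, D.ncard = k ∧ IsIsolating F G D})
    ⟨_, Set.univ, rfl, isIsolating_univ F G⟩
  by_contra! hk
  exact h D (hD.trans_le hk) hiso

lemma isolNum_pos {V W : Type*} [Finite V] [Nonempty W] {F : SimpleGraph W} {G : SimpleGraph V}
    (h : HasCopy F G) : 0 < isolNum F G := by
  refine lt_isolNum fun D hD => ?_
  rw [(Set.ncard_eq_zero D.toFinite).1 (Nat.le_zero.1 hD), isIsolating_empty_iff, not_not]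
  exact h

/-- `c v` lists the vertices of a 4-cycle of `H` that avoids `N[v]`, for every vertex `v`. -/
def IsCycleAvoidance {V : Type*} (H : SimpleGraph V) (c : V → Fin 4 → V) : Prop :=
  ∀ v, (∀ i j, c v i = c v j → i = j) ∧
    ∀ i, H.Adj (c v i) (c v (i + 1)) ∧ c v i ≠ v ∧ ¬ H.Adj v (c v i)

lemma IsCycleAvoidance.one_lt_isolNum {V W : Type*} [Finite V] [Nonempty W] {G : SimpleGraph V}
    {H : SimpleGraph W} {c : W → Fin 4 → W} (hc : IsCycleAvoidance H c) (e : G ≃g H) :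
    1 < isolNum C4 G := by
  have : Nonempty V := ⟨e.symm (Classical.arbitrary W)⟩
  refine lt_isolNum fun D hD hiso => hiso ?_
  obtain ⟨v, hv⟩ := (Set.ncard_le_one_iff_subset_singleton D.toFinite).1 hD
  obtain ⟨hinj, hcyc⟩ := hc (e v)
  have hmem : ∀ i, e.symm (c (e v) i) ∈ (closedNbhd G D)ᶜ := by
    rintro i (hi | ⟨u, hu, hui⟩)
    · exact (hcyc i).2.1 (by simpa using congrArg e (hv hi))
    · rw [hv hu] at hui
      exact (hcyc i).2.2 (by simpa using e.map_adj_iff.2 hui)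
  refine hasCopy_C4_of_adj_succ ⟨fun i => ⟨e.symm (c (e v) i), hmem i⟩, fun i j hij =>
    hinj i j (e.symm.injective (congrArg Subtype.val hij))⟩ fun i => ?_
  exact e.symm.map_adj_iff.2 (hcyc i).1

lemma isCycleAvoidance_Gr1 : IsCycleAvoidance Gr1
    ![![3, 4, 6, 5], ![4, 5, 7, 6], ![5, 6, 8, 7], ![0, 7, 6, 8],
      ![0, 1, 8, 7], ![0, 2, 1, 8], ![0, 1, 3, 2], ![1, 2, 4, 3], ![2, 3, 5, 4]] := by
  simp only [IsCycleAvoidance, Gr1, fromEdgeSet_adj, Set.mem_insert_iff, Set.mem_singleton_iff]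
  decide

lemma isCycleAvoidance_Gr2 : IsCycleAvoidance Gr2
    ![![2, 3, 4, 7], ![3, 4, 5, 6], ![0, 5, 4, 8], ![0, 1, 7, 5],
      ![0, 1, 2, 6], ![1, 2, 3, 8], ![1, 7, 4, 8], ![0, 6, 3, 8], ![2, 6, 5, 7]] := by
  simp only [IsCycleAvoidance, Gr2, fromEdgeSet_adj, Set.mem_insert_iff, Set.mem_singleton_iff]
  decide

lemma isCycleAvoidance_Gr3 : IsCycleAvoidance Gr3
    ![![2, 3, 4, 7], ![3, 4, 5, 6], ![0, 5, 4, 6], ![0, 1, 7, 5],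
      ![0, 1, 2, 8], ![1, 2, 3, 8], ![1, 7, 2, 8], ![0, 6, 3, 8], ![4, 6, 5, 7]] := by
  simp only [IsCycleAvoidance, Gr3, fromEdgeSet_adj, Set.mem_insert_iff, Set.mem_singleton_iff]
  decide

lemma isCycleAvoidance_Gr4 : IsCycleAvoidance Gr4
    ![![5, 6, 7, 8], ![3, 4, 7, 8], ![3, 4, 7, 8], ![1, 2, 5, 6],
      ![1, 2, 5, 6], ![0, 3, 7, 4], ![0, 3, 8, 4], ![0, 1, 5, 2], ![0, 1, 6, 2]] := by
  simp only [IsCycleAvoidance, Gr4, fromEdgeSet_adj, Set.mem_insert_iff, Set.mem_singleton_iff]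
  decide

lemma isCycleAvoidance_Gr5 : IsCycleAvoidance Gr5
    ![![5, 6, 7, 8], ![3, 4, 7, 8], ![3, 4, 7, 8], ![1, 5, 2, 6],
      ![1, 5, 2, 6], ![0, 3, 7, 4], ![0, 3, 8, 4], ![0, 1, 5, 2], ![0, 1, 6, 2]] := by
  simp only [IsCycleAvoidance, Gr5, fromEdgeSet_adj, Set.mem_insert_iff, Set.mem_singleton_iff]
  decide

lemma isCycleAvoidance_Gr6 : IsCycleAvoidance Gr6
    ![![5, 6, 7, 8], ![3, 7, 4, 8], ![3, 7, 4, 8], ![1, 5, 2, 6],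
      ![1, 5, 2, 6], ![0, 3, 7, 4], ![0, 3, 8, 4], ![0, 1, 5, 2], ![0, 1, 6, 2]] := by
  simp only [IsCycleAvoidance, Gr6, fromEdgeSet_adj, Set.mem_insert_iff, Set.mem_singleton_iff]
  decide

lemma hasCopy_C4_of_mem_calG4 {H : (n : ℕ) × SimpleGraph (Fin n)} (hH : H ∈ calG4) :
    H.1 = 4 ∧ HasCopy C4 H.2 := by
  rcases hH with rfl | rfl | rfl
  · exact ⟨rfl, Function.Embedding.refl _, fun a b hab => hab⟩
  · refine ⟨rfl, hasCopy_C4_of_adj_succ (Function.Embedding.refl _) ?_⟩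
    simp only [diamondGraph, fromEdgeSet_adj, Set.mem_insert_iff, Set.mem_singleton_iff]
    decide
  · exact ⟨rfl, Function.Embedding.refl _, fun a b hab => hab.ne⟩

lemma exists_isCycleAvoidance_of_mem_calG9 {H : (n : ℕ) × SimpleGraph (Fin n)}
    (hH : H ∈ calG9) : H.1 = 9 ∧ ∃ c, IsCycleAvoidance H.2 c := by
  rcases hH with rfl | rfl | rfl | rfl | rfl | rfl
  · exact ⟨rfl, _, isCycleAvoidance_Gr1⟩
  · exact ⟨rfl, _, isCycleAvoidance_Gr2⟩
  · exact ⟨rfl, _, isCycleAvoidance_Gr3⟩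
  · exact ⟨rfl, _, isCycleAvoidance_Gr4⟩
  · exact ⟨rfl, _, isCycleAvoidance_Gr5⟩
  · exact ⟨rfl, _, isCycleAvoidance_Gr6⟩

/-- If `G` is an `ℰ₄`-graph, then `ι(G, C₄) > ⌊|V(G)|/5⌋`. -/
theorem stmt15 {V : Type*} [Fintype V] (G : SimpleGraph V)
    (h : ∃ H ∈ calE4, Nonempty (G ≃g H.2)) :
    Fintype.card V / 5 < isolNum C4 G := by
  obtain ⟨⟨n, H⟩, hH, ⟨e⟩⟩ := h
  have hcard : Fintype.card V = n := by simpa using Fintype.card_congr e.toEquiv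
  rcases hH with hH | hH
  · obtain ⟨rfl, hcopy⟩ := hasCopy_C4_of_mem_calG4 hH
    rw [hcard]
    exact isolNum_pos (hcopy.trans_iso e.symm)
  · obtain ⟨rfl, c, hc⟩ := exists_isCycleAvoidance_of_mem_calG9 hH
    rw [hcard]
    exact hc.one_lt_isolNum e
end

section
/- If G is a connected graph on n vertices that is not isomorphic to the diamond graph C_4', the complete graph K_4, or the graph G_1 (the square of the 9-cycle), then ι(G, C_4') ≤ ⌊n/5⌋. -/
open SimpleGraph

namespace DiamondIsolation

lemma gr1_adj (i j : Fin 9) :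
    Gr1.Adj i j ↔ j = i + 1 ∨ j = i + 2 ∨ i = j + 1 ∨ i = j + 2 := by
  revert j
  simp only [Gr1, SimpleGraph.fromEdgeSet_adj, Set.mem_insert_iff, Set.mem_singleton_iff,
    Sym2.eq_iff]
  fin_cases i <;> simp <;> decide

open Finset
open scoped Classical

variable {V : Type*} {G : SimpleGraph V}

/-- `p, q, r, s` span a diamond whose chord is `pq`. -/
def Dia (G : SimpleGraph V) (p q r s : V) : Prop :=
  G.Adj p q ∧ G.Adj p r ∧ G.Adj p s ∧ G.Adj q r ∧ G.Adj q s ∧ r ≠ s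

/-- The subgraph induced by `T` contains no diamond. -/
def DiaFree (G : SimpleGraph V) (T : Finset V) : Prop :=
  ∀ p q r s, Dia G p q r s → p ∈ T → q ∈ T → r ∈ T → s ∉ T

/-- `T` is nonempty and induces a connected subgraph. -/
def Conn (G : SimpleGraph V) (T : Finset V) : Prop :=
  T.Nonempty ∧ ∀ A ⊆ T, A.Nonempty → (∀ u ∈ A, ∀ w ∈ T, G.Adj u w → w ∈ A) → A = T

/-- `C` induces a diamond or a `K₄`. -/
def Bad4 (G : SimpleGraph V) (C : Finset V) : Prop :=
  ∃ p q r s, Dia G p q r s ∧ C = {p, q, r, s}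

/-- `C` induces the square of a 9-cycle. -/
def Bad9 (G : SimpleGraph V) (C : Finset V) : Prop :=
  ∃ φ : Fin 9 → V, Function.Injective φ ∧
    (∀ i j, G.Adj (φ i) (φ j) ↔ j = i + 1 ∨ j = i + 2 ∨ i = j + 1 ∨ i = j + 2) ∧ C = univ.image φ

/-- `C` induces one of the exceptional graphs. -/
def Bad (G : SimpleGraph V) (C : Finset V) : Prop := Bad4 G C ∨ Bad9 G C

/-- `H` is a connected component of the subgraph induced by `T`. -/
structure IsComp (G : SimpleGraph V) (T H : Finset V) : Prop where
  sub : H ⊆ T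
  conn : Conn G H
  closed : ∀ u ∈ H, ∀ w ∈ T, G.Adj u w → w ∈ H

lemma Dia.swap {p q r s : V} (h : Dia G p q r s) : Dia G q p r s :=
  ⟨h.1.symm, h.2.2.2.1, h.2.2.2.2.1, h.2.1, h.2.2.1, h.2.2.2.2.2⟩

lemma Dia.swap' {p q r s : V} (h : Dia G p q r s) : Dia G p q s r :=
  ⟨h.1, h.2.2.1, h.2.1, h.2.2.2.2.1, h.2.2.2.1, h.2.2.2.2.2.symm⟩

lemma Dia.card {p q r s : V} (h : Dia G p q r s) : #({p, q, r, s} : Finset V) = 4 := by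
  obtain ⟨h1, h2, h3, h4, h5, h6⟩ := h
  have := h1.ne; have := h2.ne; have := h3.ne; have := h4.ne; have := h5.ne
  rw [card_insert_of_notMem (by simp_all), card_insert_of_notMem (by simp_all),
    card_insert_of_notMem (by simp_all), card_singleton]

lemma Dia.center_ne {p q r s a b c d : V} (hQ : Dia G p q r s)
    (ha : ∀ w, G.Adj a w → w = c ∨ w = b ∨ w = d) (hq : q ≠ b) (hr : r ≠ b) (hs : s ≠ b) :
    p ≠ a := by
  rintro rfl
  obtain ⟨hpq, hpr, hps, hqr, hqs, hrs⟩ := hQ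
  have := ha q hpq; have := ha r hpr; have := ha s hps; have := hqr.ne; have := hqs.ne
  grind

lemma Dia.tip_ne {p q r s a b c d : V} (hQ : Dia G p q r s)
    (ha : ∀ w, G.Adj a w → w = c ∨ w = b ∨ w = d) (hp : p ≠ b) (hq : q ≠ b) (hp' : p ≠ c)
    (hq' : q ≠ c) : r ≠ a := by
  rintro rfl
  obtain ⟨hpq, hpr, hps, hqr, hqs, hrs⟩ := hQ
  have := ha p hpr.symm; have := ha q hqr.symm; have := hpq.ne
  grind

lemma diaFree_of_card {T : Finset V} (h : #T ≤ 3) : DiaFree G T := by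
  intro p q r s hd hp hq hr hs
  have : ({p, q, r, s} : Finset V) ⊆ T := by
    intro u hu
    simp only [mem_insert, mem_singleton] at hu
    rcases hu with rfl | rfl | rfl | rfl <;> assumption
  have := card_le_card this
  rw [hd.card] at this
  omega

lemma DiaFree.mono {S T : Finset V} (h : DiaFree G T) (hST : S ⊆ T) : DiaFree G S :=
  fun p q r s hd hp hq hr hs => h p q r s hd (hST hp) (hST hq) (hST hr) (hST hs)

lemma Bad4.card {C : Finset V} (h : Bad4 G C) : #C = 4 := by
  obtain ⟨p, q, r, s, hd, rfl⟩ := h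
  exact hd.card

/-- By symmetry, any vertex of the square of a 9-cycle can be taken as the origin. -/
lemma Bad9.exists_param {C : Finset V} (h : Bad9 G C) {c : V} (hc : c ∈ C) :
    ∃ φ : Fin 9 → V, Function.Injective φ ∧
      (∀ i j, G.Adj (φ i) (φ j) ↔ j = i + 1 ∨ j = i + 2 ∨ i = j + 1 ∨ i = j + 2) ∧
      C = univ.image φ ∧ φ 0 = c := by
  obtain ⟨φ, hi, ha, rfl⟩ := h
  obtain ⟨k, -, rfl⟩ := mem_image.1 hc
  refine ⟨fun i => φ (i + k), fun i j hij => add_right_cancel (hi hij), fun i j => ?_, ?_, by simp⟩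
  · simp only [ha, add_right_comm _ k, add_left_inj]
  · ext u
    simp only [mem_image, mem_univ, true_and]
    exact ⟨fun ⟨i, hi⟩ => ⟨i - k, by simpa using hi⟩, fun ⟨i, hi⟩ => ⟨_, hi⟩⟩

lemma Bad9.card {C : Finset V} (h : Bad9 G C) : #C = 9 := by
  obtain ⟨φ, hi, -, rfl⟩ := h
  simp [card_image_of_injective _ hi]

lemma Bad.nonempty {C : Finset V} (h : Bad G C) : C.Nonempty := by
  rcases h with h | h
  · exact card_pos.1 (by simp [h.card])
  · exact card_pos.1 (by simp [h.card])

/-- A connected set that meets a component lies inside it. -/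
lemma IsComp.subset_of_mem {T H K : Finset V} (h : IsComp G T H) (hK : Conn G K) (hKT : K ⊆ T)
    {u : V} (huH : u ∈ H) (huK : u ∈ K) : K ⊆ H := by
  have := hK.2 (K ∩ H) inter_subset_left ⟨u, mem_inter.2 ⟨huK, huH⟩⟩ (by
    intro a ha w hw haw
    rw [mem_inter] at ha ⊢
    exact ⟨hw, h.closed a ha.2 w (hKT hw) haw⟩)
  exact inter_eq_left.1 this

lemma IsComp.eq_of_mem {T H K : Finset V} (h : IsComp G T H) (hK : IsComp G T K)
    {u : V} (huH : u ∈ H) (huK : u ∈ K) : H = K :=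
  (hK.subset_of_mem h.conn h.sub huK huH).antisymm (h.subset_of_mem hK.conn hK.sub huH huK)

lemma card_star {c p₁ p₂ p₃ p₄ : V} (h₁ : G.Adj c p₁) (h₂ : G.Adj c p₂) (h₃ : G.Adj c p₃)
    (h₄ : G.Adj c p₄) (hne : p₁ ≠ p₂ ∧ p₁ ≠ p₃ ∧ p₁ ≠ p₄ ∧ p₂ ≠ p₃ ∧ p₂ ≠ p₄ ∧ p₃ ≠ p₄) :
    #({c, p₁, p₂, p₃, p₄} : Finset V) = 5 := by
  obtain ⟨e₁, e₂, e₃, e₄, e₅, e₆⟩ := hne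
  have := h₁.ne; have := h₂.ne; have := h₃.ne; have := h₄.ne
  rw [card_insert_of_notMem (by simp_all), card_insert_of_notMem (by simp_all),
    card_insert_of_notMem (by simp_all), card_insert_of_notMem (by simp_all), card_singleton]

lemma Conn.comap {W : Type*} [Fintype W] {e : W ↪ V} (h : Conn G (univ.map e)) :
    Conn (G.comap e) univ := by
  refine ⟨by simpa using h.1, fun A _ hA hcl => map_injective e ?_⟩
  refine h.2 _ (map_subset_map.2 (subset_univ A)) (hA.map) fun u hu w hw huw => ?_
  obtain ⟨a, ha, rfl⟩ := mem_map.1 hu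
  obtain ⟨b, -, rfl⟩ := mem_map.1 hw
  exact mem_map_of_mem e (hcl a ha b (mem_univ b) huw)

lemma Bad.of_comap {W : Type*} {e : W ↪ V} {C : Finset W} (h : Bad (G.comap e) C) :
    Bad G (C.map e) := by
  obtain ⟨p, q, r, s, hd, rfl⟩ | ⟨φ, hφ, hadj, rfl⟩ := h
  · obtain ⟨h1, h2, h3, h4, h5, h6⟩ := hd
    exact .inl ⟨e p, e q, e r, e s, ⟨h1, h2, h3, h4, h5, e.injective.ne h6⟩, by simp⟩
  · refine .inr ⟨e ∘ φ, e.injective.comp hφ, hadj, ?_⟩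
    ext
    simp

variable [Fintype V]

/-- The closed neighbourhood of a finite set of vertices. -/
noncomputable def nbhd (G : SimpleGraph V) (D : Finset V) : Finset V :=
  univ.filter fun u => ∃ w ∈ D, w = u ∨ G.Adj w u

/-- The components of `G - Y`. -/
noncomputable def comps (G : SimpleGraph V) (Y : Finset V) : Finset (Finset V) :=
  univ.filter (IsComp G Yᶜ)

/-- The exceptional components of `G - Y`. -/
noncomputable def badComps (G : SimpleGraph V) (Y : Finset V) : Finset (Finset V) :=
  (comps G Y).filter (Bad G)

/-- A minimal counterexample to the bound. -/
structure MinCounter (G : SimpleGraph V) : Prop where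
  conn : Conn G univ
  notBad : ¬ Bad G univ
  big : ∀ D, DiaFree G (nbhd G D)ᶜ → Fintype.card V < 5 * #D
  small : ∀ T ≠ univ, Conn G T → ¬ Bad G T → ∃ D, 5 * #D ≤ #T ∧ DiaFree G (T \ nbhd G D)

lemma mem_nbhd {D : Finset V} {u : V} : u ∈ nbhd G D ↔ ∃ w ∈ D, w = u ∨ G.Adj w u := by
  simp [nbhd]

lemma mem_nbhd_singleton {v u : V} : u ∈ nbhd G {v} ↔ v = u ∨ G.Adj v u := by
  simp [nbhd]

lemma nbhd_mono {D D' : Finset V} (h : D ⊆ D') : nbhd G D ⊆ nbhd G D' := by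
  intro u hu
  rw [mem_nbhd] at hu ⊢
  obtain ⟨w, hw, h'⟩ := hu
  exact ⟨w, h hw, h'⟩

/-- Deleting one vertex from an exceptional graph makes it easy to isolate. -/
lemma Bad.exists_hit {C : Finset V} (h : Bad G C) {c : V} (hc : c ∈ C) :
    ∃ D, 5 * #D + 4 ≤ #C ∧ DiaFree G ((C.erase c) \ nbhd G D) := by
  rcases h with h | h
  · refine ⟨∅, by simp [h.card], diaFree_of_card ?_⟩
    have := card_le_card (sdiff_subset (s := C.erase c) (t := nbhd G ∅))
    rw [card_erase_of_mem hc, h.card] at this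
    exact this
  · have h9 := h.card
    obtain ⟨φ, hi, ha, rfl, rfl⟩ := h.exists_param hc
    refine ⟨{φ 4}, by simp [h9], diaFree_of_card ?_⟩
    have hs : ((univ.image φ).erase (φ 0)) \ nbhd G {φ 4} ⊆
        ({1, 7, 8} : Finset (Fin 9)).image φ := by
      intro u hu
      simp only [mem_sdiff, mem_erase, mem_image, mem_univ, true_and, mem_nbhd_singleton] at hu
      obtain ⟨⟨h0, i, rfl⟩, h4⟩ := hu
      rw [ha, hi.eq_iff] at h4
      rw [Ne, hi.eq_iff] at h0
      refine mem_image_of_mem _ ?_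
      revert i; decide
    exact (card_le_card hs).trans (card_image_le.trans (by simp))

lemma Bad.exists_isolating {C : Finset V} (h : Bad G C) :
    ∃ D, 5 * #D ≤ #C + 1 ∧ DiaFree G (C \ nbhd G D) := by
  obtain ⟨c, hc⟩ := h.nonempty
  obtain ⟨D, hD, hf⟩ := h.exists_hit hc
  refine ⟨insert c D, ?_, hf.mono ?_⟩
  · have := card_insert_le c D
    omega
  · intro u hu
    simp only [mem_sdiff, mem_erase] at hu ⊢
    refine ⟨⟨?_, hu.1⟩, fun h' => hu.2 (nbhd_mono (subset_insert c D) h')⟩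
    rintro rfl
    exact hu.2 (mem_nbhd.2 ⟨u, mem_insert_self _ _, .inl rfl⟩)

lemma mem_comps {Y H : Finset V} : H ∈ comps G Y ↔ IsComp G Yᶜ H := by simp [comps]

lemma mem_badComps {Y H : Finset V} : H ∈ badComps G Y ↔ IsComp G Yᶜ H ∧ Bad G H := by
  simp [badComps, mem_comps]

lemma exists_comp {T : Finset V} {u : V} (hu : u ∈ T) : ∃ H, IsComp G T H ∧ u ∈ H := by
  let P : Finset V → Prop := fun H => H ⊆ T ∧ u ∈ H ∧ ∀ a ∈ H, ∀ w ∈ T, G.Adj a w → w ∈ H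
  obtain ⟨H, hH⟩ := (univ.filter P).exists_minimal ⟨T, by simp [P, hu]; tauto⟩
  have hP : P H := (mem_filter.1 hH.1).2
  have hm : ∀ A, P A → A ⊆ H → H ⊆ A := fun A hA hAH => hH.2 (by simpa using hA) hAH
  obtain ⟨hs, huH, hc⟩ := hP
  refine ⟨H, ⟨hs, ⟨⟨u, huH⟩, fun A hA hne hcl => ?_⟩, hc⟩, huH⟩
  by_cases huA : u ∈ A
  · exact hA.antisymm (hm A ⟨hA.trans hs, huA, fun a ha w hw haw =>
      hcl a ha w (hc a (hA ha) w hw haw) haw⟩ hA)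
  · obtain ⟨a, ha⟩ := hne
    have := hm (H \ A) ⟨sdiff_subset.trans hs, by simp [huH, huA], fun b hb w hw hbw => by
      rw [mem_sdiff] at hb ⊢
      exact ⟨hc b hb.1 w hw hbw, fun hwA => hb.2 (hcl w hwA b hb.1 hbw.symm)⟩⟩ sdiff_subset
    exact absurd ha (mem_sdiff.1 (this (hA ha))).2

lemma sum_card_comps (Y : Finset V) : ∑ H ∈ comps G Y, #H = #Yᶜ := by
  rw [← card_biUnion]
  · congr 1
    ext u
    simp only [mem_biUnion, mem_comps]
    exact ⟨fun ⟨H, hH, hu⟩ => hH.sub hu, fun hu => exists_comp hu⟩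
  · intro H hH K hK hne
    rw [mem_coe, mem_comps] at *
    exact disjoint_left.2 fun u huH huK => hne (hH.eq_of_mem hK huH huK)

namespace MinCounter

/-- The basic count: delete `Y`, put `D` in the isolating set, and treat the components of `G - Y`
separately. -/
lemma count (h : MinCounter G) {Y D : Finset V} (hY : Y.Nonempty)
    (hits : ∀ p q r s, Dia G p q r s → p ∉ nbhd G D → q ∉ nbhd G D → r ∉ nbhd G D → s ∉ nbhd G D →
      p ∉ Y ∧ q ∉ Y ∧ r ∉ Y ∧ s ∉ Y) :
    #Y + 4 * #{H ∈ badComps G Y | ¬ Disjoint H (nbhd G D)} <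
      5 * #D + #{H ∈ badComps G Y | Disjoint H (nbhd G D)} := by
  have key : ∀ H ∈ comps G Y, ∃ E : Finset V, DiaFree G ((H \ nbhd G D) \ nbhd G E) ∧
      5 * #E + 4 * (if Bad G H ∧ ¬ Disjoint H (nbhd G D) then 1 else 0) ≤
        #H + (if Bad G H ∧ Disjoint H (nbhd G D) then 1 else 0) := by
    intro H hH
    rw [mem_comps] at hH
    by_cases hb : Bad G H
    · by_cases hd : Disjoint H (nbhd G D)
      · obtain ⟨E, hE, hf⟩ := hb.exists_isolating
        exact ⟨E, hf.mono (sdiff_subset_sdiff sdiff_subset le_rfl), by simp [hb, hd, hE]⟩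
      · obtain ⟨c, hcH, hcD⟩ := not_disjoint_iff.1 hd
        obtain ⟨E, hE, hf⟩ := hb.exists_hit hcH
        refine ⟨E, hf.mono (sdiff_subset_sdiff ?_ le_rfl), by simp [hb, hd, hE]⟩
        intro u hu
        rw [mem_sdiff] at hu
        exact mem_erase.2 ⟨fun h => hu.2 (h ▸ hcD), hu.1⟩
    · have hne : H ≠ univ := by
        rintro rfl
        obtain ⟨y, hy⟩ := hY
        exact mem_compl.1 (hH.sub (mem_univ y)) hy
      obtain ⟨E, hE, hf⟩ := h.small H hne hH.conn hb
      exact ⟨E, hf.mono (sdiff_subset_sdiff sdiff_subset le_rfl), by simp [hb, hE]⟩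
  choose! E hf hE using key
  have hbig := h.big (D ∪ (comps G Y).biUnion E) (by
    intro p q r s hd hp hq hr hs
    have hDn : ∀ u ∈ (nbhd G (D ∪ (comps G Y).biUnion E))ᶜ, u ∉ nbhd G D := fun u hu hu' =>
      mem_compl.1 hu (nbhd_mono subset_union_left hu')
    obtain ⟨hpY, hqY, hrY, hsY⟩ := hits p q r s hd (hDn p hp) (hDn q hq) (hDn r hr) (hDn s hs)
    obtain ⟨H, hH, hpH⟩ := exists_comp (G := G) (mem_compl.2 hpY)
    have hHc := mem_comps.2 hH
    have hEn : ∀ u ∈ (nbhd G (D ∪ (comps G Y).biUnion E))ᶜ, u ∈ H →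
        u ∈ (H \ nbhd G D) \ nbhd G (E H) := fun u hu huH =>
      mem_sdiff.2 ⟨mem_sdiff.2 ⟨huH, hDn u hu⟩, fun hu' =>
        mem_compl.1 hu (nbhd_mono ((subset_biUnion_of_mem E hHc).trans subset_union_right) hu')⟩
    exact hf H hHc p q r s hd (hEn p hp hpH)
      (hEn q hq (hH.closed p hpH q (mem_compl.2 hqY) hd.1))
      (hEn r hr (hH.closed p hpH r (mem_compl.2 hrY) hd.2.1))
      (hEn s hs (hH.closed p hpH s (mem_compl.2 hsY) hd.2.2.1)))
  have hsum := sum_le_sum hE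
  rw [sum_add_distrib, sum_add_distrib, ← mul_sum, ← mul_sum, sum_card_comps, ← card_filter,
    ← card_filter, ← filter_filter, ← filter_filter] at hsum
  have h1 := card_union_le D ((comps G Y).biUnion E)
  have h2 := card_biUnion_le (s := comps G Y) (t := E)
  have h3 := card_add_card_compl Y
  change _ + 4 * #{H ∈ badComps G Y | ¬ Disjoint H (nbhd G D)} ≤
    _ + #{H ∈ badComps G Y | Disjoint H (nbhd G D)} at hsum
  omega

end MinCounter

namespace MinCounter

lemma not_badComp_singleton (h : MinCounter G) (x : V) {C : Finset V} : C ∉ badComps G {x} := by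
  intro hC
  have hhit : ∀ H ∈ badComps G {x}, ¬ Disjoint H (nbhd G {x}) := by
    intro H hH hd
    have hc := (mem_badComps.1 hH).1
    have hx : x ∉ H := fun hx => by simpa using hc.sub hx
    refine hx ((h.conn.2 H (subset_univ H) hc.conn.1 fun u hu w _ huw => ?_) ▸ mem_univ x)
    refine hc.closed u hu w ?_ huw
    rw [mem_compl, mem_singleton]
    rintro rfl
    exact disjoint_left.1 hd hu (mem_nbhd_singleton.2 (.inr huw.symm))
  have := h.count (Y := {x}) (D := {x}) (singleton_nonempty x) (by
    intro p q r s hd hp hq hr hs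
    simp only [mem_nbhd_singleton, mem_singleton] at *
    grind)
  rw [filter_true_of_mem hhit, filter_false_of_mem (fun H hH => hhit H hH)] at this
  have hpos := card_pos.2 ⟨C, hC⟩
  rw [card_empty, card_singleton] at this
  omega

/-- Membership in the components of `G - N[v]`, spelled out. -/
lemma _root_.DiamondIsolation.IsComp.not_adj {v : V} {C : Finset V}
    (hC : IsComp G (nbhd G {v})ᶜ C) {u : V} (hu : u ∈ C) : v ≠ u ∧ ¬ G.Adj v u := by
  simpa [mem_nbhd_singleton] using hC.sub hu

/-- An exceptional component of `G - N[v]` has at least two attachments in `N(v)`. -/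
lemma exists_link (h : MinCounter G) {v : V} {C : Finset V} (hC : C ∈ badComps G (nbhd G {v}))
    {x : V} (hx : x ∉ C) : ∃ y, G.Adj v y ∧ y ≠ x ∧ ∃ c ∈ C, G.Adj y c := by
  by_contra! hn
  obtain ⟨hc, hb⟩ := mem_badComps.1 hC
  refine h.not_badComp_singleton x (C := C) (mem_badComps.2 ⟨⟨?_, hc.conn, ?_⟩, hb⟩)
  · intro u hu
    rw [mem_compl, mem_singleton]
    rintro rfl
    exact hx hu
  · intro u hu w hw huw
    rw [mem_compl, mem_singleton] at hw
    refine hc.closed u hu w ?_ huw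
    rw [mem_compl, mem_nbhd_singleton]
    rintro (rfl | hvw)
    · exact (hc.not_adj hu).2 huw.symm
    · exact hn w hvw hw u hu huw.symm

lemma count_nbhd (h : MinCounter G) (v : V) : #(nbhd G {v}) < 5 + #(badComps G (nbhd G {v})) := by
  have := h.count (Y := nbhd G {v}) (D := {v}) ⟨v, mem_nbhd_singleton.2 (.inl rfl)⟩
    (fun p q r s _ hp hq hr hs => ⟨hp, hq, hr, hs⟩)
  have := card_filter_le (badComps G (nbhd G {v})) (fun H => Disjoint H (nbhd G {v}))
  rw [card_singleton] at *
  omega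

/-- Adding to `v` a set of neighbours that meets all exceptional components of `G - N[v]`. -/
lemma count_hitting (h : MinCounter G) {v : V} {X : Finset V}
    (hX : ∀ H ∈ badComps G (nbhd G {v}), ∃ x ∈ X, ∃ c ∈ H, G.Adj x c) :
    #(nbhd G {v}) + 4 * #(badComps G (nbhd G {v})) < 5 * (#X + 1) := by
  have hhit : ∀ H ∈ badComps G (nbhd G {v}), ¬ Disjoint H (nbhd G (insert v X)) := by
    intro H hH
    obtain ⟨x, hx, c, hc, hxc⟩ := hX H hH
    exact not_disjoint_iff.2 ⟨c, hc, mem_nbhd.2 ⟨x, mem_insert_of_mem hx, .inr hxc⟩⟩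
  have hsub : nbhd G {v} ⊆ nbhd G (insert v X) := nbhd_mono (by simp)
  have := h.count (Y := nbhd G {v}) (D := insert v X) ⟨v, mem_nbhd_singleton.2 (.inl rfl)⟩
    (fun p q r s _ hp hq hr hs => ⟨fun h' => hp (hsub h'), fun h' => hq (hsub h'),
      fun h' => hr (hsub h'), fun h' => hs (hsub h')⟩)
  rw [filter_true_of_mem hhit, filter_false_of_mem (fun H hH => hhit H hH), card_empty] at this
  have := card_insert_le v X
  omega

/-- A neighbour of `v` is attached to at most one exceptional component of `G - N[v]`. -/
lemma link_unique (h : MinCounter G) {v : V} {C₁ C₂ : Finset V}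
    (h₁ : C₁ ∈ badComps G (nbhd G {v})) (h₂ : C₂ ∈ badComps G (nbhd G {v})) {x c₁ c₂ : V}
    (hx : G.Adj v x) (hc₁ : c₁ ∈ C₁) (hc₂ : c₂ ∈ C₂) (hx₁ : G.Adj x c₁) (hx₂ : G.Adj x c₂) :
    C₁ = C₂ := by
  by_contra hne
  have hout : ∀ {y H}, G.Adj v y → H ∈ badComps G (nbhd G {v}) → y ∉ H := fun hy hH hyH =>
    ((mem_badComps.1 hH).1.not_adj hyH).2 hy
  have hlink : ∀ H ∈ badComps G (nbhd G {v}), ∃ y, y ≠ x ∧ G.Adj v y ∧ ∃ c ∈ H, G.Adj y c := by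
    intro H hH
    obtain ⟨y, hy, hyx, hc⟩ := h.exists_link hH (hout hx hH)
    exact ⟨y, hyx, hy, hc⟩
  have : Nonempty V := ⟨x⟩
  choose! f hfx hfv hfc using hlink
  set B := badComps G (nbhd G {v}) with hB
  have hcount₁ := h.count_hitting (v := v) (X := insert x (((B.erase C₁).erase C₂).image f)) (by
    intro H hH
    by_cases e₁ : H = C₁
    · exact ⟨x, by simp, c₁, e₁ ▸ hc₁, hx₁⟩
    by_cases e₂ : H = C₂
    · exact ⟨x, by simp, c₂, e₂ ▸ hc₂, hx₂⟩
    · exact ⟨f H, mem_insert_of_mem (mem_image_of_mem f (by simp [e₁, e₂, hB, hH])), hfc H hH⟩)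
  have hcount₂ := h.count_hitting (v := v) (X := ((nbhd G {v}).erase v).erase x) (by
    intro H hH
    exact ⟨f H, by simp [hfx H hH, (hfv H hH).ne', mem_nbhd_singleton, hfv H hH], hfc H hH⟩)
  have hcard₁ : #(insert x (((B.erase C₁).erase C₂).image f)) + 1 ≤ #B := by
    have a := card_insert_le x (((B.erase C₁).erase C₂).image f)
    have b := card_image_le (s := (B.erase C₁).erase C₂) (f := f)
    rw [card_erase_of_mem (by simp [h₂, Ne.symm hne]), card_erase_of_mem h₁] at b
    have : 1 < #B := one_lt_card.2 ⟨C₁, h₁, C₂, h₂, hne⟩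
    omega
  have hcard₂ : #(((nbhd G {v}).erase v).erase x) + 2 = #(nbhd G {v}) := by
    rw [card_erase_of_mem (by simp [hx.ne', mem_nbhd_singleton, hx]),
      card_erase_of_mem (by simp [mem_nbhd_singleton])]
    have : 1 < #(nbhd G {v}) := one_lt_card.2
      ⟨v, by simp [mem_nbhd_singleton], x, by simp [mem_nbhd_singleton, hx], hx.ne⟩
    omega
  rw [← hB] at hcount₁ hcount₂
  omega

/-- Seen from a vertex `c` of an exceptional component `C` of `G - N[v]`, every exceptional
component avoiding `v` is part of `C`. -/
lemma subset_of_notMem (h : MinCounter G) {v c : V} {C K : Finset V}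
    (hC : C ∈ badComps G (nbhd G {v})) (hc : c ∈ C) (hK : K ∈ badComps G (nbhd G {c}))
    (hv : v ∉ K) : K ⊆ C := by
  obtain ⟨hCc, hCb⟩ := mem_badComps.1 hC
  obtain ⟨hKc, hKb⟩ := mem_badComps.1 hK
  obtain ⟨hvc, hvc'⟩ := hCc.not_adj hc
  have hvN : v ∈ (nbhd G {c})ᶜ := by
    simp [mem_nbhd_singleton, hvc.symm, G.adj_comm c v, hvc']
  have hKv : ∀ u ∈ K, ¬ G.Adj v u := fun u hu hvu => hv (hKc.closed u hu v hvN hvu.symm)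
  have hKN : K ⊆ (nbhd G {v})ᶜ := by
    intro u hu
    simp only [mem_compl, mem_nbhd_singleton, not_or]
    exact ⟨fun e => hv (e ▸ hu), hKv u hu⟩
  by_contra hKC
  have hdisj : ∀ u ∈ K, u ∉ C := fun u hu huC => hKC (hCc.subset_of_mem hKc.conn hKN huC hu)
  have hK' : K ∈ badComps G (nbhd G {v}) := by
    refine mem_badComps.2 ⟨⟨hKN, hKc.conn, fun u hu w hw huw => hKc.closed u hu w ?_ huw⟩, hKb⟩
    simp only [mem_compl, mem_nbhd_singleton, not_or]
    refine ⟨?_, fun hcw => ?_⟩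
    · rintro rfl
      exact (hKc.not_adj hu).2 huw.symm
    · exact hdisj u hu (hCc.closed w (hCc.closed c hc w hw hcw) u (hKN hu) huw.symm)
  obtain ⟨y, hvy, -, u, hu, hyu⟩ := h.exists_link hK' (x := v) hv
  have hyc : G.Adj c y := by
    by_contra hyc
    refine hKv y (hKc.closed u hu y ?_ hyu.symm) hvy
    simp only [mem_compl, mem_nbhd_singleton, not_or]
    refine ⟨?_, hyc⟩
    rintro rfl
    exact hvc' hvy
  exact hdisj c ((h.link_unique hK' hC hvy hu hc hyu hyc.symm) ▸ hc) hc

/-- No component of `G - N[v]` is the square of a 9-cycle. -/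
lemma not_bad9 (h : MinCounter G) {v : V} {C : Finset V} (hC : C ∈ badComps G (nbhd G {v})) :
    ¬ Bad9 G C := by
  intro h9
  obtain ⟨hCc, hCb⟩ := mem_badComps.1 hC
  obtain ⟨x, hvx, -, c, hc, hxc⟩ := h.exists_link hC (x := v) (fun hv => (hCc.not_adj hv).1 rfl)
  have hxC : x ∉ C := fun hx => (hCc.not_adj hx).2 hvx
  obtain ⟨φ, hi, ha, hCφ, rfl⟩ := h9.exists_param hc
  have hφC : ∀ i, φ i ∈ C := fun i => hCφ ▸ mem_image_of_mem φ (mem_univ i)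
  have hxφ : ∀ i, x ≠ φ i := fun i e => hxC (e ▸ hφC i)
  set M : Finset V := ({3, 4, 5, 6} : Finset (Fin 9)).image φ with hM
  have hMcard : #M = 4 := by rw [card_image_of_injective _ hi]; rfl
  have hsubM : ∀ K ∈ badComps G (nbhd G {φ 0}), v ∉ K → K = M := by
    intro K hK hv
    have hKC := h.subset_of_notMem hC hc hK hv
    have hKc := (mem_badComps.1 hK).1
    have hsub : K ⊆ M := by
      intro u hu
      have h1 := hKc.not_adj hu
      have h2 := hKC hu
      rw [hCφ] at h2
      obtain ⟨i, -, rfl⟩ := mem_image.1 h2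
      rw [ha, hi.ne_iff] at h1
      refine mem_image_of_mem φ ?_
      clear hu h2
      revert i; decide
    refine eq_of_subset_of_card_le hsub ?_
    rw [hMcard]
    rcases (mem_badComps.1 hK).2 with hb | hb
    · exact hb.card.ge
    · rw [hb.card]; omega
  have hnb : ∀ i ∈ ({0, 1, 2, 7, 8} : Finset (Fin 9)), φ i ∈ nbhd G {φ 0} := by
    intro i hi'
    rw [mem_nbhd_singleton, ha, hi.eq_iff]
    revert i; decide
  have hsix : insert x (({0, 1, 2, 7, 8} : Finset (Fin 9)).image φ) ⊆ nbhd G {φ 0} := by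
    intro u hu
    rcases mem_insert.1 hu with rfl | hu
    · exact mem_nbhd_singleton.2 (.inr hxc.symm)
    · obtain ⟨i, hi', rfl⟩ := mem_image.1 hu
      exact hnb i hi'
  have hsixc : #(insert x (({0, 1, 2, 7, 8} : Finset (Fin 9)).image φ)) = 6 := by
    rw [card_insert_of_notMem, card_image_of_injective _ hi]
    · rfl
    · intro hx
      obtain ⟨i, -, e⟩ := mem_image.1 hx
      exact hxφ i e.symm
  have hcount := h.count_nbhd (φ 0)
  have hge : 6 ≤ #(nbhd G {φ 0}) := hsixc ▸ card_le_card hsix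
  -- exceptional components of `G - N[c]`: at most `M` and the one containing `v`
  have hw : ∀ K ∈ badComps G (nbhd G {φ 0}), ∀ K' ∈ badComps G (nbhd G {φ 0}), v ∈ K → v ∈ K' →
      K = K' := fun K hK K' hK' hv hv' =>
    (mem_badComps.1 hK).1.eq_of_mem (mem_badComps.1 hK').1 hv hv'
  have hvM : v ∉ M := by
    intro hv
    obtain ⟨i, -, rfl⟩ := mem_image.1 hv
    exact (hCc.not_adj (hφC i)).1 rfl
  have hle : #(badComps G (nbhd G {φ 0})) ≤ 2 := by
    by_contra! h3
    obtain ⟨A, B, D, hA, hB, hD, hAB, hAD, hBD⟩ := two_lt_card_iff.1 h3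
    by_cases hvA : v ∈ A
    · by_cases hvB : v ∈ B
      · exact hAB (hw A hA B hB hvA hvB)
      · by_cases hvD : v ∈ D
        · exact hAD (hw A hA D hD hvA hvD)
        · exact hBD ((hsubM B hB hvB).trans (hsubM D hD hvD).symm)
    · by_cases hvB : v ∈ B
      · by_cases hvD : v ∈ D
        · exact hBD (hw B hB D hD hvB hvD)
        · exact hAD ((hsubM A hA hvA).trans (hsubM D hD hvD).symm)
      · exact hAB ((hsubM A hA hvA).trans (hsubM B hB hvB).symm)
  have hN : insert x (({0, 1, 2, 7, 8} : Finset (Fin 9)).image φ) = nbhd G {φ 0} :=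
    eq_of_subset_of_card_le hsix (by omega)
  obtain ⟨K, hK, hvK, hMb⟩ : ∃ K ∈ badComps G (nbhd G {φ 0}), v ∈ K ∧
      M ∈ badComps G (nbhd G {φ 0}) := by
    obtain ⟨A, hA, B, hB, hAB⟩ := one_lt_card.1
      (show 1 < #(badComps G (nbhd G {φ 0})) by omega)
    by_cases hvA : v ∈ A
    · by_cases hvB : v ∈ B
      · exact absurd (hw A hA B hB hvA hvB) hAB
      · exact ⟨A, hA, hvA, hsubM B hB hvB ▸ hB⟩
    · by_cases hvB : v ∈ B
      · exact ⟨B, hB, hvB, hsubM A hA hvA ▸ hA⟩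
      · exact absurd ((hsubM A hA hvA).trans (hsubM B hB hvB).symm) hAB
  have hKc := (mem_badComps.1 hK).1
  have hKM : K ≠ M := fun e => hvM (e ▸ hvK)
  obtain ⟨y, hvy, hyx, c', hc', hyc'⟩ := h.exists_link hC hxC
  have hyC : y ∉ C := fun hy => (hCc.not_adj hy).2 hvy
  have hyK : y ∈ K := by
    refine hKc.closed v hvK y ?_ hvy
    rw [mem_compl, ← hN, mem_insert, mem_image]
    rintro (e | ⟨i, -, rfl⟩)
    · exact hyx e
    · exact hyC (hφC i)
  rw [hCφ] at hc'
  obtain ⟨i, -, rfl⟩ := mem_image.1 hc'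
  have hiM : i ∉ ({3, 4, 5, 6} : Finset (Fin 9)) := by
    intro hi'
    have hiM : φ i ∈ M := mem_image_of_mem φ hi'
    have := hKc.closed y hyK (φ i) ((mem_badComps.1 hMb).1.sub hiM) hyc'
    exact hKM (hKc.eq_of_mem (mem_badComps.1 hMb).1 this hiM)
  have hi0 : i ≠ 0 := by
    rintro rfl
    exact (hKc.not_adj hyK).2 hyc'.symm
  obtain ⟨j, hj, hij, h0i⟩ : ∃ j ∈ ({3, 4, 5, 6} : Finset (Fin 9)), G.Adj (φ i) (φ j) ∧
      G.Adj (φ 0) (φ i) := by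
    simp only [ha]
    clear hyc' hc'
    revert i; decide
  exact hKM (h.link_unique hK hMb h0i hyK (mem_image_of_mem φ hj) hyc'.symm hij)

lemma bad4 (h : MinCounter G) {v : V} {C : Finset V} (hC : C ∈ badComps G (nbhd G {v})) :
    Bad4 G C :=
  (mem_badComps.1 hC).2.resolve_right (h.not_bad9 hC)

/-- Every exceptional component of `G - N[c]` contains `v`, for `c` in an exceptional component of
`G - N[v]`. -/
lemma mem_of_badComp (h : MinCounter G) {v c : V} {C K : Finset V}
    (hC : C ∈ badComps G (nbhd G {v})) (hc : c ∈ C) (hK : K ∈ badComps G (nbhd G {c})) : v ∈ K := by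
  by_contra hv
  have hcK : c ∉ K := fun hcK => ((mem_badComps.1 hK).1.not_adj hcK).1 rfl
  have := card_lt_card ((h.subset_of_notMem hC hc hK hv).ssubset_of_mem_notMem hc hcK)
  rw [(h.bad4 hC).card, (h.bad4 hK).card] at this
  omega

lemma card_nbhd_le (h : MinCounter G) {v c : V} {C : Finset V}
    (hC : C ∈ badComps G (nbhd G {v})) (hc : c ∈ C) : #(nbhd G {c}) ≤ 5 := by
  have := h.count_nbhd c
  have : #(badComps G (nbhd G {c})) ≤ 1 := card_le_one.2 fun K hK K' hK' =>
    (mem_badComps.1 hK).1.eq_of_mem (mem_badComps.1 hK').1 (h.mem_of_badComp hC hc hK)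
      (h.mem_of_badComp hC hc hK')
  omega

lemma exists_badComp (h : MinCounter G) {v : V} (hv : 5 ≤ #(nbhd G {v})) :
    ∃ C, C ∈ badComps G (nbhd G {v}) := by
  have := h.count_nbhd v
  exact card_pos.1 (by omega)

lemma exists_badComp_mem (h : MinCounter G) {v c : V} {C : Finset V}
    (hC : C ∈ badComps G (nbhd G {v})) (hc : c ∈ C) (h5 : 5 ≤ #(nbhd G {c})) :
    ∃ K ∈ badComps G (nbhd G {c}), v ∈ K := by
  obtain ⟨K, hK⟩ := h.exists_badComp h5
  exact ⟨K, hK, h.mem_of_badComp hC hc hK⟩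

/-- If `x` is attached to the four vertices `C` and no diamond of `G - N[x]` meets `C`, then some
exceptional component of `G - (C ∪ {x})` is not attached to `x`. -/
lemma exists_unhit (h : MinCounter G) {x : V} {C : Finset V} (hC : #C = 4) (hx : x ∉ C)
    (hits : ∀ p q r s, Dia G p q r s → p ∉ nbhd G {x} → q ∉ nbhd G {x} → r ∉ nbhd G {x} →
      s ∉ nbhd G {x} → p ∉ C ∧ q ∉ C ∧ r ∉ C ∧ s ∉ C) :
    ∃ M ∈ badComps G (insert x C), ∀ m ∈ M, ¬ G.Adj x m := by
  have := h.count (Y := insert x C) (D := {x}) (insert_nonempty x C) (by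
    intro p q r s hd hp hq hr hs
    have := hits p q r s hd hp hq hr hs
    simp only [mem_nbhd_singleton, mem_insert] at *
    grind)
  rw [card_insert_of_notMem hx, hC, card_singleton] at this
  obtain ⟨M, hM⟩ := card_pos.1
    (show 0 < #{H ∈ badComps G (insert x C) | Disjoint H (nbhd G {x})} by omega)
  rw [mem_filter] at hM
  exact ⟨M, hM.1, fun m hm hxm =>
    disjoint_left.1 hM.2 hm (mem_nbhd_singleton.2 (.inr hxm))⟩

/-- If `x ∈ N(v)` is attached to an exceptional component `C` of `G - N[v]`, then some diamond of
`G - N[x]` meets `C`. -/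
lemma exists_dia (h : MinCounter G) {v x : V} {C : Finset V}
    (hC : C ∈ badComps G (nbhd G {v})) (hvx : G.Adj v x) :
    ∃ p q r s, Dia G p q r s ∧ (∀ u ∈ ({p, q, r, s} : Finset V), u ≠ x ∧ ¬ G.Adj x u) ∧
      (p ∈ C ∨ q ∈ C ∨ r ∈ C ∨ s ∈ C) := by
  by_contra! hn
  have hCc := (mem_badComps.1 hC).1
  obtain ⟨M, hM, hMx⟩ := h.exists_unhit (x := x) (h.bad4 hC).card
    (fun hx => (hCc.not_adj hx).2 hvx) (by
      intro p q r s hd hp hq hr hs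
      refine hn p q r s hd ?_
      simp only [mem_nbhd_singleton, mem_insert, mem_singleton] at *
      grind)
  obtain ⟨hMc, hMb⟩ := mem_badComps.1 hM
  have hMsub : ∀ u ∈ M, u ≠ x ∧ u ∉ C := fun u hu => by simpa using hMc.sub hu
  have hvC : v ∉ C := fun hv => (hCc.not_adj hv).1 rfl
  have hvM : v ∉ M := fun hv => hMx v hv hvx.symm
  have hMv : ∀ u ∈ M, ¬ G.Adj v u := fun u hu hvu =>
    hvM (hMc.closed u hu v (by simp [hvx.ne, hvC]) hvu.symm)
  have hM' : M ∈ badComps G (nbhd G {v}) := by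
    refine mem_badComps.2 ⟨⟨?_, hMc.conn, fun u hu w hw huw => hMc.closed u hu w ?_ huw⟩, hMb⟩
    · intro u hu
      simp only [mem_compl, mem_nbhd_singleton, not_or]
      exact ⟨fun e => hvM (e ▸ hu), hMv u hu⟩
    · simp only [mem_compl, mem_insert, not_or]
      refine ⟨?_, fun hwC => (hMsub u hu).2 (hCc.closed w hwC u ?_ huw.symm)⟩
      · rintro rfl
        exact hMx u hu huw.symm
      · simp only [mem_compl, mem_nbhd_singleton, not_or]
        exact ⟨fun e => hvM (e ▸ hu), hMv u hu⟩
  obtain ⟨y, hvy, hyx, m, hm, hym⟩ := h.exists_link hM' (x := x) (fun hx => (hMsub x hx).1 rfl)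
  refine hMv y (hMc.closed m hm y ?_ hym.symm) hvy
  simp only [mem_compl, mem_insert, not_or]
  exact ⟨hyx, fun hy => (hCc.not_adj hy).2 hvy⟩

end MinCounter

lemma star_subset_nbhd {c p₁ p₂ p₃ p₄ : V} (h₁ : G.Adj c p₁) (h₂ : G.Adj c p₂) (h₃ : G.Adj c p₃)
    (h₄ : G.Adj c p₄) : ({c, p₁, p₂, p₃, p₄} : Finset V) ⊆ nbhd G {c} := by
  intro u hu
  simp only [mem_insert, mem_singleton] at hu
  rw [mem_nbhd_singleton]
  rcases hu with rfl | rfl | rfl | rfl | rfl <;> simp [*]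

lemma five_le_card_nbhd {c p₁ p₂ p₃ p₄ : V} (h₁ : G.Adj c p₁) (h₂ : G.Adj c p₂) (h₃ : G.Adj c p₃)
    (h₄ : G.Adj c p₄) (hne : p₁ ≠ p₂ ∧ p₁ ≠ p₃ ∧ p₁ ≠ p₄ ∧ p₂ ≠ p₃ ∧ p₂ ≠ p₄ ∧ p₃ ≠ p₄) :
    5 ≤ #(nbhd G {c}) :=
  (card_star h₁ h₂ h₃ h₄ hne).ge.trans (card_le_card (star_subset_nbhd h₁ h₂ h₃ h₄))

/-- If `c` has four given neighbours and no room for more, these are all of its neighbours. -/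
lemma mem_of_adj_of_card_le {c p₁ p₂ p₃ p₄ w : V} (h : #(nbhd G {c}) ≤ 5)
    (h₁ : G.Adj c p₁) (h₂ : G.Adj c p₂) (h₃ : G.Adj c p₃) (h₄ : G.Adj c p₄)
    (hne : p₁ ≠ p₂ ∧ p₁ ≠ p₃ ∧ p₁ ≠ p₄ ∧ p₂ ≠ p₃ ∧ p₂ ≠ p₄ ∧ p₃ ≠ p₄) (hw : G.Adj c w) :
    w = p₁ ∨ w = p₂ ∨ w = p₃ ∨ w = p₄ := by
  have hmem : w ∈ nbhd G {c} := mem_nbhd_singleton.2 (.inr hw)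
  rw [← eq_of_subset_of_card_le (star_subset_nbhd h₁ h₂ h₃ h₄)
    (h.trans (card_star h₁ h₂ h₃ h₄ hne).ge)] at hmem
  simpa [hw.ne'] using hmem

/-- If `c` has three given neighbours and room for only one more, there is at most one more. -/
lemma eq_of_adj_of_card_le {c p₁ p₂ p₃ x y : V} (h : #(nbhd G {c}) ≤ 5)
    (h₁ : G.Adj c p₁) (h₂ : G.Adj c p₂) (h₃ : G.Adj c p₃) (hne : p₁ ≠ p₂ ∧ p₁ ≠ p₃ ∧ p₂ ≠ p₃)
    (hx : G.Adj c x) (hy : G.Adj c y) (hxp : x ≠ p₁ ∧ x ≠ p₂ ∧ x ≠ p₃)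
    (hyp : y ≠ p₁ ∧ y ≠ p₂ ∧ y ≠ p₃) : x = y := by
  rcases mem_of_adj_of_card_le h h₁ h₂ h₃ hx ⟨hne.1, hne.2.1, hxp.1.symm, hne.2.2, hxp.2.1.symm,
    hxp.2.2.symm⟩ hy with e | e | e | e
  · exact absurd e hyp.1
  · exact absurd e hyp.2.1
  · exact absurd e hyp.2.2
  · exact e.symm

namespace MinCounter

/-- Neighbours outside of an exceptional component of `G - N[v]` belong to `N(v)`. -/
lemma adj_of_adj {v u w : V} {C : Finset V} (hC : C ∈ badComps G (nbhd G {v}))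
    (hu : u ∈ C) (hw : w ∉ C) (huw : G.Adj u w) : G.Adj v w := by
  have hCc := (mem_badComps.1 hC).1
  by_contra hvw
  refine hw (hCc.closed u hu w ?_ huw)
  simp only [mem_compl, mem_nbhd_singleton, not_or]
  refine ⟨?_, hvw⟩
  rintro rfl
  exact (hCc.not_adj hu).2 huw.symm

/-- No component of `G - N[v]` is a `K₄`. -/
lemma not_adj_of_dia (h : MinCounter G) {v a b c d : V} (hd : Dia G a c b d)
    (hC : {a, c, b, d} ∈ badComps G (nbhd G {v})) : ¬ G.Adj b d := by
  intro hbd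
  obtain ⟨hac, hab, had, hcb, hcd, -⟩ := hd
  set C : Finset V := {a, c, b, d} with hCe
  have hCc := (mem_badComps.1 hC).1
  have hone : ∀ u ∈ C, ∀ x ∉ C, ∀ y ∉ C, G.Adj u x → G.Adj u y → x = y := by
    intro u hu x hx y hy hux huy
    have hN := h.card_nbhd_le hC hu
    simp only [hCe, mem_insert, mem_singleton, not_or] at hu hx hy
    obtain ⟨xa, xc, xb, xd⟩ := hx
    obtain ⟨ya, yc, yb, yd⟩ := hy
    have hbd' := hbd.ne
    rcases hu with rfl | rfl | rfl | rfl
    · exact eq_of_adj_of_card_le hN hac hab had ⟨hcb.ne, hcd.ne, hbd'⟩ hux huy ⟨xc, xb, xd⟩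
        ⟨yc, yb, yd⟩
    · exact eq_of_adj_of_card_le hN hac.symm hcb hcd ⟨hab.ne, had.ne, hbd'⟩ hux huy
        ⟨xa, xb, xd⟩ ⟨ya, yb, yd⟩
    · exact eq_of_adj_of_card_le hN hab.symm hcb.symm hbd ⟨hac.ne, had.ne, hcd.ne⟩ hux huy
        ⟨xa, xc, xd⟩ ⟨ya, yc, yd⟩
    · exact eq_of_adj_of_card_le hN had.symm hcd.symm hbd.symm ⟨hac.ne, hab.ne, hcb.ne⟩ hux huy
        ⟨xa, xc, xb⟩ ⟨ya, yc, yb⟩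
  have key : ∀ x, G.Adj v x → (∃ c₀ ∈ C, G.Adj x c₀) → ∃ t, ∃ u₁ ∈ C, ∃ u₂ ∈ C, ∃ u₃ ∈ C,
      t ∉ C ∧ G.Adj t u₁ ∧ G.Adj t u₂ ∧ u₁ ≠ u₂ ∧ u₁ ≠ u₃ ∧ u₂ ≠ u₃ ∧
      ¬ G.Adj x u₁ ∧ ¬ G.Adj x u₂ ∧ ¬ G.Adj x u₃ := by
    rintro x hvx ⟨c₀, hc₀, hxc₀⟩
    obtain ⟨p, q, r, s, hQ, hx, hm⟩ := h.exists_dia hC hvx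
    have hnot : ¬ (p ∈ C ∧ q ∈ C ∧ r ∈ C ∧ s ∈ C) := by
      rintro ⟨hp, hq, hr, hs⟩
      have hsub : ({p, q, r, s} : Finset V) ⊆ C := by
        intro u hu
        simp only [mem_insert, mem_singleton] at hu
        rcases hu with rfl | rfl | rfl | rfl <;> assumption
      have heq := eq_of_subset_of_card_le hsub (by rw [hQ.card, (h.bad4 hC).card])
      exact (hx c₀ (heq ▸ hc₀)).2 hxc₀
    simp only [mem_insert, mem_singleton, forall_eq_or_imp, forall_eq] at hx
    obtain ⟨⟨-, hxp⟩, ⟨-, hxq⟩, ⟨-, hxr⟩, -, hxs⟩ := hx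
    obtain ⟨hpq, hpr, hps, hqr, hqs, hrs⟩ := hQ
    by_cases hp : p ∈ C
    · have e₁ := hone p hp q
      have e₂ := hone p hp r
      by_cases hq : q ∈ C
      · by_cases hr : r ∈ C
        · exact ⟨s, p, hp, q, hq, r, hr, fun hs => hnot ⟨hp, hq, hr, hs⟩, hps.symm, hqs.symm,
            hpq.ne, hpr.ne, hqr.ne,
            hxp, hxq, hxr⟩
        · have hs : s ∈ C := by
            by_contra hs
            exact hrs (e₂ hr s hs hpr hps)
          exact ⟨r, p, hp, q, hq, s, hs, hr, hpr.symm, hqr.symm, hpq.ne, hps.ne, hqs.ne,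
            hxp, hxq, hxs⟩
      · have hr : r ∈ C := by
          by_contra hr
          exact hqr.ne (e₁ hq r hr hpq hpr)
        have hs : s ∈ C := by
          by_contra hs
          exact hqs.ne (e₁ hq s hs hpq hps)
        exact ⟨q, p, hp, r, hr, s, hs, hq, hpq.symm, hqr, hpr.ne, hps.ne, hrs, hxp, hxr, hxs⟩
    · have e : ∀ u ∈ C, G.Adj u p → ∀ y, G.Adj u y → y ≠ p → y ∈ C := by
        intro u hu hup y huy hyp
        by_contra hy
        exact hyp (hone u hu p hp y hy hup huy).symm
      have hq : q ∈ C := by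
        rcases hm with hm | hm | hm | hm
        · exact absurd hm hp
        · exact hm
        · exact e r hm hpr.symm q hqr.symm hpq.ne'
        · exact e s hm hps.symm q hqs.symm hpq.ne'
      exact ⟨p, q, hq, r, e q hq hpq.symm r hqr hpr.ne', s, e q hq hpq.symm s hqs hps.ne', hp,
        hpq, hpr, hqr.ne, hqs.ne, hrs, hxq, hxr, hxs⟩
  have hvC : v ∉ C := fun hv => (hCc.not_adj hv).1 rfl
  obtain ⟨x, hvx, -, c₀, hc₀⟩ := h.exists_link hC hvC
  obtain ⟨t, u₁, hu₁, u₂, hu₂, -, -, ht, ht₁, ht₂, hu, -⟩ := key x hvx ⟨c₀, hc₀⟩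
  obtain ⟨-, w₁, hw₁, w₂, hw₂, w₃, hw₃, -, -, -, hw₁₂, hw₁₃, hw₂₃, n₁, n₂, n₃⟩ :=
    key t (adj_of_adj hC hu₁ ht ht₁.symm) ⟨u₁, hu₁, ht₁⟩
  have hsub : ({u₁, u₂, w₁, w₂, w₃} : Finset V) ⊆ C := by
    intro u hu
    simp only [mem_insert, mem_singleton] at hu
    rcases hu with rfl | rfl | rfl | rfl | rfl <;> assumption
  have hne : ∀ {y z}, G.Adj t y → ¬ G.Adj t z → y ≠ z := fun hy hz e => hz (e ▸ hy)
  have hcard : #({u₁, u₂, w₁, w₂, w₃} : Finset V) = 5 := by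
    rw [card_insert_of_notMem (by simp [hu, hne ht₁ n₁, hne ht₁ n₂, hne ht₁ n₃]),
      card_insert_of_notMem (by simp [hne ht₂ n₁, hne ht₂ n₂, hne ht₂ n₃]),
      card_insert_of_notMem (by simp [hw₁₂, hw₁₃]), card_insert_of_notMem (by simp [hw₂₃]),
      card_singleton]
  have := card_le_card hsub
  rw [hcard, (h.bad4 hC).card] at this
  omega

/-- If the centres `a, c` of an exceptional component have no neighbour outside, then a neighbour
`x` of `b` forces two adjacent external neighbours of `d` with a further common neighbour. -/
lemma exists_of_closed_centers (h : MinCounter G) {v a b c d x : V} (hd : Dia G a c b d)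
    (hC : {a, c, b, d} ∈ badComps G (nbhd G {v})) (ha : ∀ w, G.Adj a w → w = c ∨ w = b ∨ w = d)
    (hc : ∀ w, G.Adj c w → w = a ∨ w = b ∨ w = d) (hvx : G.Adj v x) (hxb : G.Adj x b) :
    ∃ y y' s, Dia G y y' d s ∧ y ∉ ({a, c, b, d} : Finset V) ∧ y' ∉ ({a, c, b, d} : Finset V) ∧
      s ∉ ({a, c, b, d} : Finset V) ∧ (y ≠ x ∧ y' ≠ x ∧ s ≠ x) ∧
      ¬ G.Adj x y ∧ ¬ G.Adj x y' ∧ ¬ G.Adj x s ∧ ¬ G.Adj x d := by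
  obtain ⟨hac, hab, had, hcb, hcd, hbd⟩ := hd
  have hdN := h.card_nbhd_le hC (c := d) (by simp)
  have hb : ∀ {u}, ¬ G.Adj x u → u ≠ b := fun hu e => hu (e ▸ hxb)
  -- in a diamond avoiding `N[x]`, neither a centre nor a tip is one of `a`, `b`, `c`
  have center : ∀ p q r s, Dia G p q r s → ¬ G.Adj x p → ¬ G.Adj x q → ¬ G.Adj x r →
      ¬ G.Adj x s → p ≠ a ∧ p ≠ c := by
    intro p q r s hQ xp xq xr xs
    exact ⟨hQ.center_ne ha (hb xq) (hb xr) (hb xs), hQ.center_ne hc (hb xq) (hb xr) (hb xs)⟩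
  have tip : ∀ p q r s, Dia G p q r s → ¬ G.Adj x p → ¬ G.Adj x q → ¬ G.Adj x r →
      ¬ G.Adj x s → r ≠ a ∧ r ≠ c := by
    intro p q r s hQ xp xq xr xs
    obtain ⟨pa, pc⟩ := center p q r s hQ xp xq xr xs
    obtain ⟨qa, qc⟩ := center q p r s hQ.swap xq xp xr xs
    exact ⟨hQ.tip_ne ha (hb xp) (hb xq) pc qc, hQ.tip_ne hc (hb xp) (hb xq) pa qa⟩
  have center' : ∀ p q r s, Dia G p q r s → ¬ G.Adj x p → ¬ G.Adj x q → ¬ G.Adj x r →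
      ¬ G.Adj x s → p ≠ d := by
    rintro p q r s hQ xp xq xr xs rfl
    obtain ⟨qa, qc⟩ := center q p r s hQ.swap xq xp xr xs
    obtain ⟨ra, rc⟩ := tip p q r s hQ xp xq xr xs
    obtain ⟨sa, sc⟩ := tip p q s r hQ.swap' xp xq xs xr
    obtain ⟨hpq, hpr, hps, hqr, hqs, hrs⟩ := hQ
    exact hrs (eq_of_adj_of_card_le hdN had.symm hcd.symm hpq ⟨hac.ne, qa.symm, qc.symm⟩ hpr hps
      ⟨ra, rc, hqr.ne'⟩ ⟨sa, sc, hqs.ne'⟩)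
  have main : ∀ p q s, Dia G p q d s → (p ≠ x ∧ q ≠ x ∧ s ≠ x) → ¬ G.Adj x p → ¬ G.Adj x q →
      ¬ G.Adj x d → ¬ G.Adj x s → ∃ y y' s, Dia G y y' d s ∧ y ∉ ({a, c, b, d} : Finset V) ∧
      y' ∉ ({a, c, b, d} : Finset V) ∧ s ∉ ({a, c, b, d} : Finset V) ∧
      (y ≠ x ∧ y' ≠ x ∧ s ≠ x) ∧ ¬ G.Adj x y ∧ ¬ G.Adj x y' ∧ ¬ G.Adj x s ∧ ¬ G.Adj x d := by
    intro p q s hQ hx xp xq xd xs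
    have h₁ := center p q d s hQ xp xq xd xs
    have h₂ := center q p d s hQ.swap xq xp xd xs
    have h₃ := tip p q s d hQ.swap' xp xq xs xd
    refine ⟨p, q, s, hQ, ?_, ?_, ?_, hx, xp, xq, xs, xd⟩ <;>
      simp only [mem_insert, mem_singleton, not_or]
    · exact ⟨h₁.1, h₁.2, hb xp, hQ.2.1.ne⟩
    · exact ⟨h₂.1, h₂.2, hb xq, hQ.2.2.2.1.ne⟩
    · exact ⟨h₃.1, h₃.2, hb xs, hQ.2.2.2.2.2.symm⟩
  obtain ⟨p, q, r, s, hQ, hx, hm⟩ := h.exists_dia hC hvx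
  simp only [mem_insert, mem_singleton, forall_eq_or_imp, forall_eq] at hx hm
  obtain ⟨⟨px, xp⟩, ⟨qx, xq⟩, ⟨rx, xr⟩, sx, xs⟩ := hx
  have h₁ := center p q r s hQ xp xq xr xs
  have h₂ := center q p r s hQ.swap xq xp xr xs
  have h₃ := tip p q r s hQ xp xq xr xs
  have h₄ := tip p q s r hQ.swap' xp xq xs xr
  have h₅ := center' p q r s hQ xp xq xr xs
  have h₆ := center' q p r s hQ.swap xq xp xr xs
  have hrs : r = d ∨ s = d := by
    have := hb xp; have := hb xq; have := hb xr; have := hb xs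
    grind
  rcases hrs with rfl | rfl
  · exact main p q s hQ ⟨px, qx, sx⟩ xp xq xr xs
  · exact main p q r hQ.swap' ⟨px, qx, rx⟩ xp xq xs xr

lemma not_adj_of_closed_centers (h : MinCounter G) {v a b c d x : V} (hd : Dia G a c b d)
    (hC : {a, c, b, d} ∈ badComps G (nbhd G {v})) (ha : ∀ w, G.Adj a w → w = c ∨ w = b ∨ w = d)
    (hc : ∀ w, G.Adj c w → w = a ∨ w = b ∨ w = d) (hvx : G.Adj v x) : ¬ G.Adj x b := by
  intro hxb
  have hC' : {a, c, d, b} ∈ badComps G (nbhd G {v}) := by rwa [Finset.pair_comm d b]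
  have hCc := (mem_badComps.1 hC).1
  have hdb := fun e => h.not_adj_of_dia hd hC (G.adj_symm e)
  obtain ⟨y, y', s, hQ, yC, y'C, sC, ⟨yx, y'x, sx⟩, xy, xy', xs, xd⟩ :=
    h.exists_of_closed_centers hd hC ha hc hvx hxb
  obtain ⟨hyy', hyd, hys, hy'd, hy's, hds⟩ := hQ
  have hdC : d ∈ ({a, c, b, d} : Finset V) := by simp
  have hvy := adj_of_adj hC hdC yC hyd.symm
  have hvy' := adj_of_adj hC hdC y'C hy'd.symm
  have ha' := fun w hw => (ha w hw).imp_right Or.symm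
  have hc' := fun w hw => (hc w hw).imp_right Or.symm
  obtain ⟨-, -, -, -, -, -, -, -, -, -, -, yb⟩ :=
    h.exists_of_closed_centers hd.swap' hC' ha' hc' hvy hyd
  obtain ⟨-, -, -, -, -, -, -, -, -, -, -, y'b⟩ :=
    h.exists_of_closed_centers hd.swap' hC' ha' hc' hvy' hy'd
  obtain ⟨z, z', _, hZ, zC, z'C, -⟩ := h.exists_of_closed_centers hd.swap' hC' ha' hc' hvy hyd
  obtain ⟨hzz', hzb, -, hz'b, -, -⟩ := hZ
  have hxC : x ∉ ({a, c, b, d} : Finset V) := fun hx => (hCc.not_adj hx).2 hvx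
  obtain ⟨hac, hab, had, hcb, hcd, hbd⟩ := hd
  simp only [mem_insert, mem_singleton, not_or] at hxC zC z'C yC y'C sC
  have hbN := h.card_nbhd_le hC (c := b) (by simp)
  have hne : a ≠ c ∧ a ≠ z ∧ a ≠ z' ∧ c ≠ z ∧ c ≠ z' ∧ z ≠ z' :=
    ⟨hac.ne, Ne.symm zC.1, Ne.symm z'C.1, Ne.symm zC.2.1, Ne.symm z'C.2.1, hzz'.ne⟩
  have hfull : ∀ w, G.Adj b w → w = a ∨ w = c ∨ w = z ∨ w = z' := fun w hw =>
    mem_of_adj_of_card_le hbN hab.symm hcb.symm hzb.symm hz'b.symm hne hw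
  have hx' : ∀ w, G.Adj b w → w = a ∨ w = c ∨ w = x ∨ G.Adj x w := by
    intro w hw
    have := hfull x hxb.symm
    have := hfull w hw
    have := hzz'.symm
    grind
  have h5 : 5 ≤ #(nbhd G {b}) := five_le_card_nbhd hab.symm hcb.symm hzb.symm hz'b.symm hne
  obtain ⟨K, hK, hvK⟩ := h.exists_badComp_mem hC (c := b) (by simp) h5
  have hKc := (mem_badComps.1 hK).1
  have hcl : ∀ u ∈ K, ∀ w, b ≠ w → ¬ G.Adj b w → G.Adj u w → w ∈ K := fun u hu w hbw hbw' huw =>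
    hKc.closed u hu w (by simp [mem_nbhd_singleton, hbw, hbw']) huw
  have hyK := hcl v hvK y (Ne.symm yC.2.2.1) (fun e => yb e.symm) hvy
  have hy'K := hcl v hvK y' (Ne.symm y'C.2.2.1) (fun e => y'b e.symm) hvy'
  have hdK := hcl y hyK d hbd (fun e => hdb e.symm) hyd
  have hsK := hcl y hyK s (Ne.symm sC.2.2.1) (fun e => by
    rcases hx' s e with e | e | e | e
    · exact sC.1 e
    · exact sC.2.1 e
    · exact sx e
    · exact xs e) hys
  have hvd := (hCc.not_adj hdC).1
  have hvs : v ≠ s := fun e => xs (e ▸ hvx.symm)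
  have hsub : ({v, y, y', d, s} : Finset V) ⊆ K := by
    intro u hu
    simp only [mem_insert, mem_singleton] at hu
    rcases hu with rfl | rfl | rfl | rfl | rfl <;> assumption
  have := card_le_card hsub
  rw [(h.bad4 hK).card, card_insert_of_notMem, card_insert_of_notMem, card_insert_of_notMem,
      card_insert_of_notMem, card_singleton] at this
  · omega
  · simpa using hds
  · simp [hy'd.ne, hy's.ne]
  · simp [hyy'.ne, hyd.ne, hys.ne]
  · simp [hvy.ne, hvy'.ne, hvd, hvs]

/-- A centre of an exceptional component of `G - N[v]` has a neighbour outside. -/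
lemma exists_adj_center (h : MinCounter G) {v a b c d : V} (hd : Dia G a c b d)
    (hC : {a, c, b, d} ∈ badComps G (nbhd G {v})) :
    ∃ x ∉ ({a, c, b, d} : Finset V), G.Adj a x ∨ G.Adj c x := by
  by_contra! hn
  have ha : ∀ w, G.Adj a w → w = c ∨ w = b ∨ w = d := by
    intro w hw
    by_contra hw'
    refine (hn w ?_).1 hw
    simp only [mem_insert, mem_singleton, not_or] at hw' ⊢
    exact ⟨hw.ne', hw'⟩
  have hc : ∀ w, G.Adj c w → w = a ∨ w = b ∨ w = d := by
    intro w hw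
    by_contra hw'
    refine (hn w ?_).2 hw
    simp only [mem_insert, mem_singleton, not_or] at hw' ⊢
    exact ⟨hw'.1, hw.ne', hw'.2⟩
  have hCc := (mem_badComps.1 hC).1
  obtain ⟨x, hvx, -, u, hu, hxu⟩ := h.exists_link hC (x := v) (fun hv => (hCc.not_adj hv).1 rfl)
  have hx : x ∉ ({a, c, b, d} : Finset V) := fun hx => (hCc.not_adj hx).2 hvx
  simp only [mem_insert, mem_singleton] at hu
  rcases hu with rfl | rfl | rfl | rfl
  · exact (hn x hx).1 hxu.symm
  · exact (hn x hx).2 hxu.symm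
  · exact h.not_adj_of_closed_centers hd hC ha hc hvx hxu
  · exact h.not_adj_of_closed_centers hd.swap' (by rwa [Finset.pair_comm u b])
      (fun w hw => (ha w hw).imp_right Or.symm) (fun w hw => (hc w hw).imp_right Or.symm) hvx hxu

end MinCounter
lemma forall_of_three {V : Type*} {P : V → Prop} {y₁ y₂ y₃ p q r : V}
    (hp : p = y₁ ∨ p = y₂ ∨ p = y₃) (hq : q = y₁ ∨ q = y₂ ∨ q = y₃)
    (hr : r = y₁ ∨ r = y₂ ∨ r = y₃) (hpq : p ≠ q) (hpr : p ≠ r) (hqr : q ≠ r)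
    (Pp : P p) (Pq : P q) (Pr : P r) : P y₁ ∧ P y₂ ∧ P y₃ := by
  grind

/-- Two exceptional components seen from a centre of each other, with a common neighbour `x` of
the two centres. -/
structure Config (G : SimpleGraph V) (v f e g a c b d x : V) : Prop where
  left : {v, f, e, g} ∈ badComps G (nbhd G {a})
  right : {a, c, b, d} ∈ badComps G (nbhd G {v})
  diaLeft : Dia G v f e g
  diaRight : Dia G a c b d
  adjLeft : G.Adj v x
  adjRight : G.Adj a x

namespace Config

variable {v f e g a c b d x : V}

lemma symm (k : Config G v f e g a c b d x) : Config G a c b d v f e g x :=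
  ⟨k.right, k.left, k.diaRight, k.diaLeft, k.adjRight, k.adjLeft⟩

lemma flip (k : Config G v f e g a c b d x) : Config G v f g e a c b d x :=
  ⟨Finset.pair_comm e g ▸ k.left, k.right, k.diaLeft.swap', k.diaRight, k.adjLeft, k.adjRight⟩

lemma notMem (k : Config G v f e g a c b d x) : v ≠ a ∧ v ≠ c ∧ v ≠ b ∧ v ≠ d ∧
    ¬ G.Adj v a ∧ ¬ G.Adj v c ∧ ¬ G.Adj v b ∧ ¬ G.Adj v d := by
  have := fun u (hu : u ∈ ({a, c, b, d} : Finset V)) => (mem_badComps.1 k.right).1.not_adj hu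
  simp only [mem_insert, mem_singleton, forall_eq_or_imp, forall_eq] at this
  tauto

lemma ne (k : Config G v f e g a c b d x) (u : V) (hu : G.Adj v u) :
    u ≠ a ∧ u ≠ c ∧ u ≠ b ∧ u ≠ d := by
  obtain ⟨-, -, -, -, h₁, h₂, h₃, h₄⟩ := k.notMem
  refine ⟨?_, ?_, ?_, ?_⟩ <;> rintro rfl <;> contradiction

lemma adj_center (k : Config G v f e g a c b d x) (h : MinCounter G) {w : V} (hw : G.Adj v w) :
    w = f ∨ w = e ∨ w = g ∨ w = x := by
  obtain ⟨-, hf, he, hg⟩ := k.symm.ne x k.adjRight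
  obtain ⟨hvf, hve, hvg, hfe, hfg, heg⟩ := k.diaLeft
  exact mem_of_adj_of_card_le (h.card_nbhd_le k.left (by simp)) hvf hve hvg k.adjLeft
    ⟨hfe.ne, hfg.ne, hf.symm, heg, he.symm, hg.symm⟩ hw

lemma adj_of_mem (k : Config G v f e g a c b d x) (h : MinCounter G) {u w : V}
    (hu : u ∈ ({a, c, b, d} : Finset V)) (hw : G.Adj u w) :
    (w = a ∨ w = c ∨ w = b ∨ w = d) ∨ w = f ∨ w = e ∨ w = g ∨ w = x := by
  by_cases hwC : w ∈ ({a, c, b, d} : Finset V)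
  · exact .inl (by simpa using hwC)
  · exact .inr (k.adj_center h (MinCounter.adj_of_adj k.right hu hwC hw))

lemma exists_dia (k : Config G v f e g a c b d x) (h : MinCounter G) :
    ∃ p q r s, Dia G p q r s ∧ ∀ u ∈ ({p, q, r, s} : Finset V), ¬ G.Adj x u ∧
      ((u = c ∨ u = b ∨ u = d) ∨ u = f ∨ u = e ∨ u = g) := by
  obtain ⟨p, q, r, s, hQ, hx, hm⟩ := h.exists_dia k.right k.adjLeft
  have hx' : ∀ u ∈ ({p, q, r, s} : Finset V), u ≠ x ∧ u ≠ a ∧ u ≠ v := fun u hu =>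
    ⟨(hx u hu).1, fun e => (hx u hu).2 (e ▸ k.adjRight.symm),
      fun e => (hx u hu).2 (e ▸ k.adjLeft.symm)⟩
  let S : V → Prop := fun u => (u = c ∨ u = b ∨ u = d) ∨ u = f ∨ u = e ∨ u = g
  have step : ∀ u w, S u → G.Adj u w → w ≠ x ∧ w ≠ a ∧ w ≠ v → S w := by
    rintro u w (hu | hu) huw ⟨wx, wa, wv⟩
    · have := k.adj_of_mem h (u := u) (by simp [hu]) huw
      exact this.imp (fun t => t.resolve_left wa)
        fun t => t.imp_right fun t => t.imp_right fun t => t.resolve_right wx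
    · have := k.symm.adj_of_mem h (u := u) (by simp [hu]) huw
      exact this.symm.imp (fun t => t.imp_right fun t => t.imp_right fun t => t.resolve_right wx)
        fun t => t.resolve_left wv
  have start : ∀ u, u ∈ ({a, c, b, d} : Finset V) → u ≠ x ∧ u ≠ a ∧ u ≠ v → S u := by
    intro u hu hu'
    simp only [mem_insert, mem_singleton] at hu
    exact .inl (hu.resolve_left hu'.2.1)
  simp only [mem_insert, mem_singleton, forall_eq_or_imp, forall_eq] at hx hx'
  obtain ⟨px, qx, rx, sx⟩ := hx'
  have hp : S p := by
    rcases hm with hm | hm | hm | hm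
    · exact start p hm px
    · exact step q p (start q hm qx) hQ.1.symm px
    · exact step r p (start r hm rx) hQ.2.1.symm px
    · exact step s p (start s hm sx) hQ.2.2.1.symm px
  refine ⟨p, q, r, s, hQ, ?_⟩
  simp only [mem_insert, mem_singleton, forall_eq_or_imp, forall_eq]
  exact ⟨⟨hx.1.2, hp⟩, ⟨hx.2.1.2, step p q hp hQ.1 qx⟩, ⟨hx.2.2.1.2, step p r hp hQ.2.1 rx⟩,
    hx.2.2.2.2, step p s hp hQ.2.2.1 sx⟩

/-- The vertex `c` sends at most one edge to the other side. -/
lemma cross_unique (k : Config G v f e g a c b d x) (h : MinCounter G) {y z : V}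
    (hy : y = f ∨ y = e ∨ y = g) (hz : z = f ∨ z = e ∨ z = g) (hcy : G.Adj c y)
    (hcz : G.Adj c z) : y = z := by
  obtain ⟨hac, hab, had, hcb, hcd, hbd⟩ := k.diaRight
  obtain ⟨hvf, hve, hvg, -, -, -⟩ := k.diaLeft
  have out : ∀ u, (u = f ∨ u = e ∨ u = g) → u ≠ a ∧ u ≠ b ∧ u ≠ d := by
    rintro u (rfl | rfl | rfl)
    · have := k.ne u hvf; tauto
    · have := k.ne u hve; tauto
    · have := k.ne u hvg; tauto
  exact eq_of_adj_of_card_le (h.card_nbhd_le k.right (by simp)) hac.symm hcb hcd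
    ⟨hab.ne, had.ne, hbd⟩ hcy hcz (out y hy) (out z hz)

/-- No vertex of `{b, c, d}` is adjacent to all of `e, f, g`. -/
lemma not_cross (k : Config G v f e g a c b d x) (h : MinCounter G) {u : V}
    (hu : u = c ∨ u = b ∨ u = d) (hf : G.Adj u f) (he : G.Adj u e) (hg : G.Adj u g) : False := by
  have hc : ∀ b d, Config G v f e g a c b d x → G.Adj b f → G.Adj b e → G.Adj b g → False := by
    intro b d k hf he hg
    obtain ⟨hac, hab, had, hcb, hcd, hbd⟩ := k.diaRight
    obtain ⟨hvf, hve, hvg, hfe, hfg, heg⟩ := k.diaLeft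
    obtain ⟨fa, fc, -, -⟩ := k.ne f hvf
    obtain ⟨ea, ec, -, -⟩ := k.ne e hve
    obtain ⟨ga, gc, -, -⟩ := k.ne g hvg
    exact heg (eq_of_adj_of_card_le (h.card_nbhd_le k.right (by simp)) hab.symm hcb.symm hf
      ⟨hac.ne, fa.symm, fc.symm⟩ he hg ⟨ea, ec, hfe.ne'⟩ ⟨ga, gc, hfg.ne'⟩)
  rcases hu with rfl | rfl | rfl
  · exact k.diaLeft.2.2.2.2.2 (k.cross_unique h (by simp) (by simp) he hg)
  · exact hc u d k hf he hg
  · exact hc u b k.symm.flip.symm hf he hg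

/-- The last case, which leads to the square of the 9-cycle. -/
lemma false_of_adj (k : Config G v f e g a c b d x) (h : MinCounter G)
    (xb : ¬ G.Adj x b) (xc : ¬ G.Adj x c) (xe : ¬ G.Adj x e) (xf : ¬ G.Adj x f)
    (hbe : G.Adj b e) (hbf : G.Adj b f) (hce : G.Adj c e) : False := by
  obtain ⟨hva, hvc, hvb, hvd, nva, nvc, nvb, nvd⟩ := k.notMem
  obtain ⟨hxv, hxf, hxe, hxg⟩ := k.symm.ne x k.adjRight
  obtain ⟨hxa, hxc, hxb, hxd⟩ := k.ne x k.adjLeft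
  have hNv := fun w => k.adj_center h (w := w)
  have hNa := fun w => k.symm.adj_center h (w := w)
  have hvx := k.adjLeft
  have hax := k.adjRight
  obtain ⟨hvf, hve, hvg, hfe, hfg, heg⟩ := k.diaLeft
  obtain ⟨hac, hab, had, hcb, hcd, hbd⟩ := k.diaRight
  obtain ⟨hfa, hfc, hfb, hfd⟩ := k.ne f hvf
  obtain ⟨hea, hec, heb, hed⟩ := k.ne e hve
  obtain ⟨hga, hgc, hgb, hgd⟩ := k.ne g hvg
  have card : ∀ u, u = v ∨ u = f ∨ u = e ∨ u = g ∨ u = a ∨ u = c ∨ u = b ∨ u = d →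
      #(nbhd G {u}) ≤ 5 := by
    rintro u (hu | hu | hu | hu | hu)
    iterate 4 exact h.card_nbhd_le k.left (c := u) (by simp [hu])
    exact h.card_nbhd_le k.right (c := u) (by simpa using hu)
  have five := five_le_card_nbhd hab.symm hcb.symm hbe hbf
    ⟨hac.ne, hea.symm, hfa.symm, hec.symm, hfc.symm, hfe.ne'⟩
  obtain ⟨M, hM, hvM⟩ := h.exists_badComp_mem k.right (c := b) (by simp) five
  have hMc := (mem_badComps.1 hM).1
  have hMv : ∀ w ∈ M, G.Adj v w → w = g ∨ w = x := by
    intro w hw hvw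
    have hbw := (hMc.not_adj hw).2
    rcases hNv w hvw with rfl | rfl | hw | hw
    · exact absurd hbf hbw
    · exact absurd hbe hbw
    · exact .inl hw
    · exact .inr hw
  obtain ⟨z, hMz, hgx, hzg, hzx, hzv⟩ : ∃ z, (∀ w, w ∈ M ↔ w = v ∨ w = g ∨ w = x ∨ w = z) ∧
      G.Adj g x ∧ G.Adj z g ∧ G.Adj z x ∧ z ≠ v := by
    obtain ⟨p, q, r, s, hQ, hMe⟩ := h.bad4 hM
    have center : ∀ p q r s, Dia G p q r s → q ∈ M → r ∈ M → s ∈ M → v ≠ p := by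
      rintro p q r s ⟨hpq, hpr, hps, hqr, hqs, hrs⟩ hq hr hs rfl
      have := hqr.ne; have := hqs.ne
      rcases hMv q hq hpq with rfl | rfl <;> rcases hMv r hr hpr with rfl | rfl <;>
        rcases hMv s hs hps with rfl | rfl <;> contradiction
    have tip : ∀ p q s, Dia G p q v s → M = {p, q, v, s} → ∃ z, (∀ w, w ∈ M ↔
        w = v ∨ w = g ∨ w = x ∨ w = z) ∧ G.Adj g x ∧ G.Adj z g ∧ G.Adj z x ∧ z ≠ v := by
      rintro p q s ⟨hpq, hpv, hps, hqv, hqs, hvs⟩ hMe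
      have hpM := hMv p (by simp [hMe]) hpv.symm
      have hqM := hMv q (by simp [hMe]) hqv.symm
      rcases hpM with rfl | rfl <;> rcases hqM with rfl | rfl
      · exact absurd hpq (SimpleGraph.irrefl G)
      · exact ⟨s, fun w => by simp only [hMe, mem_insert, mem_singleton]; tauto, hpq, hps.symm,
          hqs.symm, hvs.symm⟩
      · exact ⟨s, fun w => by simp only [hMe, mem_insert, mem_singleton]; tauto, hpq.symm,
          hqs.symm, hps.symm, hvs.symm⟩
      · exact absurd hpq (SimpleGraph.irrefl G)
    have hp : p ∈ M := by simp [hMe]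
    have hq : q ∈ M := by simp [hMe]
    have hr : r ∈ M := by simp [hMe]
    have hs : s ∈ M := by simp [hMe]
    have hv := hvM
    rw [hMe] at hv
    simp only [mem_insert, mem_singleton] at hv
    rcases hv with hv | hv | rfl | rfl
    · exact absurd hv (center p q r s hQ hq hr hs)
    · exact absurd hv (center q p r s hQ.swap hp hr hs)
    · exact tip p q s hQ hMe
    · exact tip p q r hQ.swap' (by rw [hMe, Finset.pair_comm])
  obtain rfl : z = d := by
    have hzM := hMc.not_adj ((hMz z).2 (by simp))
    rcases k.symm.adj_of_mem h (u := g) (by simp) hzg.symm with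
      (hz | hz | hz | hz) | hz | hz | hz | hz
    · exact absurd hz hzv
    · exact absurd (hz ▸ hbf) hzM.2
    · exact absurd (hz ▸ hbe) hzM.2
    · exact absurd hz hzg.ne
    · exact absurd (hz ▸ hcb.symm) hzM.2
    · exact absurd hz.symm hzM.1
    · exact hz
    · exact absurd hz hzx.ne
  have := hfe.ne; have := hfg.ne; have := hac.ne; have := hab.ne; have := had.ne
  have := hcb.ne; have := hcd.ne; have := hvf.ne; have := hve.ne; have := hvg.ne
  have hNx : ∀ w, G.Adj x w → w = g ∨ w = v ∨ w = z ∨ w = a := by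
    intro w hw
    by_cases hwM : w ∈ M
    · rcases (hMz w).1 hwM with rfl | rfl | rfl | rfl
      · simp
      · simp
      · exact absurd hw (SimpleGraph.irrefl G)
      · simp
    · have hwb : b = w ∨ G.Adj b w := by
        by_contra hwb
        exact hwM (hMc.closed x ((hMz x).2 (by simp)) w
          (by rwa [mem_compl, mem_nbhd_singleton]) hw)
      rcases hwb with rfl | hwb
      · exact absurd hw xb
      · rcases mem_of_adj_of_card_le (card b (by simp)) hab.symm hcb.symm hbe hbf
          ⟨hac.ne, hea.symm, hfa.symm, hec.symm, hfc.symm, hfe.ne'⟩ hwb with rfl | rfl | rfl | rfl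
        · simp
        · exact absurd hw xc
        · exact absurd hw xe
        · exact absurd hw xf
  let φ : Fin 9 → V := ![e, b, c, a, z, x, g, v, f]
  have hi : Function.Injective φ := by
    have hnd : [e, b, c, a, z, x, g, v, f].Nodup := by
      simp only [List.nodup_cons, List.mem_cons, List.not_mem_nil, not_or, not_false_eq_true,
        List.nodup_nil, and_true]
      and_intros <;> first | assumption | (apply Ne.symm; assumption)
    exact List.nodup_ofFn.1 hnd
  have hN : ∀ i w, G.Adj (φ i) w ↔ w = φ (i + 1) ∨ w = φ (i + 2) ∨ w = φ (i - 1) ∨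
      w = φ (i - 2) := by
    have key : ∀ {u p₁ p₂ p₃ p₄ : V}, #(nbhd G {u}) ≤ 5 → G.Adj u p₁ → G.Adj u p₂ → G.Adj u p₃ →
        G.Adj u p₄ → (p₁ ≠ p₂ ∧ p₁ ≠ p₃ ∧ p₁ ≠ p₄ ∧ p₂ ≠ p₃ ∧ p₂ ≠ p₄ ∧ p₃ ≠ p₄) →
        ∀ w, G.Adj u w ↔ w = p₁ ∨ w = p₂ ∨ w = p₃ ∨ w = p₄ := by
      intro u p₁ p₂ p₃ p₄ hu h₁ h₂ h₃ h₄ hne w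
      refine ⟨mem_of_adj_of_card_le hu h₁ h₂ h₃ h₄ hne, ?_⟩
      rintro (rfl | rfl | rfl | rfl) <;> assumption
    intro i w
    fin_cases i
    · have := key (card e (by simp)) hbe.symm hce.symm hfe.symm hve.symm (by grind)
      exact this w
    · have := key (card b (by simp)) hcb.symm hab.symm hbe hbf (by grind)
      exact this w
    · have := key (card c (by simp)) hac.symm hcd hcb hce (by grind)
      exact this w
    · have := key (card a (by simp)) had hax hac hab (by grind)
      exact this w
    · have := key (card z (by simp)) hzx hzg had.symm hcd.symm (by grind)
      exact this w
    · refine ⟨hNx w, ?_⟩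
      rintro (hw | hw | hw | hw) <;> rw [hw]
      exacts [hgx.symm, hvx.symm, hzx.symm, hax.symm]
    · have := key (card g (by simp)) hvg.symm hfg.symm hgx hzg.symm (by grind)
      exact this w
    · have := key (card v (by simp)) hvf hve hvg hvx (by grind)
      exact this w
    · have := key (card f (by simp)) hfe hbf.symm hvf.symm hfg (by grind)
      exact this w
  refine h.notBad (.inr ⟨φ, hi, fun i j => ?_, ?_⟩)
  · rw [hN]
    simp only [hi.eq_iff]
    clear hN hi
    revert i j
    decide
  · refine (h.conn.2 _ (subset_univ _) (univ_nonempty.image φ) fun u hu w _ huw => ?_).symm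
    obtain ⟨i, -, rfl⟩ := mem_image.1 hu
    rcases (hN i w).1 huw with hw | hw | hw | hw <;> rw [hw] <;>
      exact mem_image_of_mem φ (mem_univ _)

lemma false (k : Config G v f e g a c b d x) (h : MinCounter G) : False := by
  have same : ∀ {v f e g a c b d}, Config G v f e g a c b d x →
      ∀ p q r s, Dia G p q r s → (p = c ∨ p = b ∨ p = d) → (q = c ∨ q = b ∨ q = d) →
      ((r = c ∨ r = b ∨ r = d) ∨ r = f ∨ r = e ∨ r = g) →
      ((s = c ∨ s = b ∨ s = d) ∨ s = f ∨ s = e ∨ s = g) → False := by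
    intro v f e g a c b d k
    have hbd := h.not_adj_of_dia k.diaRight k.right
    have aux : ∀ p q r s, Dia G p q r s → p = c → (q = b ∨ q = d) →
        ((r = c ∨ r = b ∨ r = d) ∨ r = f ∨ r = e ∨ r = g) →
        ((s = c ∨ s = b ∨ s = d) ∨ s = f ∨ s = e ∨ s = g) → False := by
      rintro p q r s ⟨hpq, hpr, hps, hqr, hqs, hrs⟩ rfl hq hr hs
      have out : ∀ u, G.Adj p u → G.Adj q u →
          ((u = p ∨ u = b ∨ u = d) ∨ u = f ∨ u = e ∨ u = g) → u = f ∨ u = e ∨ u = g := by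
        rintro u hpu hqu ((hu | hu | hu) | hu)
        · exact absurd hu hpu.ne'
        · rcases hq with hq | hq
          · exact absurd (hu.trans hq.symm) hqu.ne'
          · exact absurd (hu ▸ hq ▸ hqu.symm) hbd
        · rcases hq with hq | hq
          · exact absurd (hu ▸ hq ▸ hqu) hbd
          · exact absurd (hu.trans hq.symm) hqu.ne'
        · exact hu
      exact hrs (k.cross_unique h (out r hpr hqr hr) (out s hps hqs hs) hpr hps)
    rintro p q r s hQ (hp | hp) hq hr hs
    · exact aux p q r s hQ hp (hq.resolve_left (hp ▸ hQ.1.ne')) hr hs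
    · rcases hq with hq | hq
      · exact aux q p r s hQ.swap hq hp hr hs
      · have := hQ.1
        rcases hp with rfl | rfl <;> rcases hq with rfl | rfl
        · exact this.ne rfl
        · exact hbd this
        · exact hbd this.symm
        · exact this.ne rfl
  have mixed : ∀ p q r s, Dia G p q r s → ¬ G.Adj x p → ¬ G.Adj x q → ¬ G.Adj x r →
      ¬ G.Adj x s → (p = c ∨ p = b ∨ p = d) → (q = f ∨ q = e ∨ q = g) →
      (r = c ∨ r = b ∨ r = d) → (s = f ∨ s = e ∨ s = g) → False := by
    rintro p q r s ⟨hpq, hpr, hps, hqr, hqs, hrs⟩ xp xq xr xs hp hq hr hs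
    have hbd := h.not_adj_of_dia k.diaRight k.right
    have heg := h.not_adj_of_dia k.diaLeft k.left
    have hp' : p ≠ c := fun e => hqs.ne (k.cross_unique h hq hs (e ▸ hpq) (e ▸ hps))
    have hq' : q ≠ f := fun e => hpr.ne (k.symm.cross_unique h hp hr (e ▸ hpq.symm) (e ▸ hqr))
    have hr' : r = c := by
      rcases hr with hr | hr | hr
      · exact hr
      · rcases hp with hp | hp | hp <;> subst hp hr
        · exact absurd rfl hp'
        · exact absurd hpr (SimpleGraph.irrefl G)
        · exact absurd hpr.symm hbd
      · rcases hp with hp | hp | hp <;> subst hp hr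
        · exact absurd rfl hp'
        · exact absurd hpr hbd
        · exact absurd hpr (SimpleGraph.irrefl G)
    have hs' : s = f := by
      rcases hs with hs | hs | hs
      · exact hs
      · rcases hq with hq | hq | hq <;> subst hq hs
        · exact absurd rfl hq'
        · exact absurd hqs (SimpleGraph.irrefl G)
        · exact absurd hqs.symm heg
      · rcases hq with hq | hq | hq <;> subst hq hs
        · exact absurd rfl hq'
        · exact absurd hqs heg
        · exact absurd hqs (SimpleGraph.irrefl G)
    subst hr' hs'
    rcases hp.resolve_left hp' with rfl | rfl <;> rcases hq.resolve_left hq' with rfl | rfl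
    · exact k.false_of_adj h xp xr xq xs hpq hps hqr.symm
    · exact k.flip.false_of_adj h xp xr xq xs hpq hps hqr.symm
    · exact k.symm.flip.symm.false_of_adj h xp xr xq xs hpq hps hqr.symm
    · exact k.symm.flip.symm.flip.false_of_adj h xp xr xq xs hpq hps hqr.symm
  have cross : ∀ p q r s, Dia G p q r s → ¬ G.Adj x p → ¬ G.Adj x q → ¬ G.Adj x r →
      ¬ G.Adj x s → (p = c ∨ p = b ∨ p = d) → (q = f ∨ q = e ∨ q = g) →
      ((r = c ∨ r = b ∨ r = d) ∨ r = f ∨ r = e ∨ r = g) →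
      ((s = c ∨ s = b ∨ s = d) ∨ s = f ∨ s = e ∨ s = g) → False := by
    intro p q r s hQ xp xq xr xs hp hq hr hs
    obtain ⟨hpq, hpr, hps, hqr, hqs, hrs⟩ := id hQ
    rcases hr with hr | hr <;> rcases hs with hs | hs
    · obtain ⟨h₁, h₂, h₃⟩ := forall_of_three hp hr hs hpr.ne hps.ne hrs hpq.symm hqr hqs
      exact k.symm.not_cross h hq h₁ h₂ h₃
    · exact mixed p q r s hQ xp xq xr xs hp hq hr hs
    · exact mixed p q s r hQ.swap' xp xq xs xr hp hq hs hr
    · obtain ⟨h₁, h₂, h₃⟩ := forall_of_three hq hr hs hqr.ne hqs.ne hrs hpq hpr hps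
      exact k.not_cross h hp h₁ h₂ h₃
  obtain ⟨p, q, r, s, hQ, hx⟩ := k.exists_dia h
  simp only [mem_insert, mem_singleton, forall_eq_or_imp, forall_eq] at hx
  obtain ⟨⟨xp, hp⟩, ⟨xq, hq⟩, ⟨xr, hr⟩, xs, hs⟩ := hx
  rcases hp with hp | hp <;> rcases hq with hq | hq
  · exact same k p q r s hQ hp hq hr hs
  · exact cross p q r s hQ xp xq xr xs hp hq hr hs
  · exact cross q p r s hQ.swap xq xp xr xs hq hp hr hs
  · exact same k.symm p q r s hQ hp hq hr.symm hs.symm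

end Config
namespace MinCounter

/-- In a minimal counterexample every vertex has degree at most 3. -/
lemma card_nbhd_le_four (h : MinCounter G) (v : V) : #(nbhd G {v}) ≤ 4 := by
  by_contra! h5
  obtain ⟨C, hC⟩ := h.exists_badComp (v := v) h5
  obtain ⟨a₀, c₀, b, d, hd₀, rfl⟩ := h.bad4 hC
  have key : ∀ a c, Dia G a c b d → {a, c, b, d} ∈ badComps G (nbhd G {v}) →
      ∀ x ∉ ({a, c, b, d} : Finset V), ¬ G.Adj a x := by
    intro a c hd hC x hx hax
    have hvx := adj_of_adj hC (by simp) hx hax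
    have haC : a ∈ ({a, c, b, d} : Finset V) := by simp
    have five : 5 ≤ #(nbhd G {a}) := by
      simp only [mem_insert, mem_singleton, not_or] at hx
      exact five_le_card_nbhd hd.1 hd.2.1 hd.2.2.1 hax ⟨hd.2.2.2.1.ne, hd.2.2.2.2.1.ne,
        Ne.symm hx.2.1, hd.2.2.2.2.2, Ne.symm hx.2.2.1, Ne.symm hx.2.2.2⟩
    obtain ⟨K, hK, hvK⟩ := h.exists_badComp_mem hC haC five
    have hva := (mem_badComps.1 hC).1.not_adj haC
    have hsub : (nbhd G {v}).erase x ⊆ K := by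
      intro w hw
      rw [mem_erase, mem_nbhd_singleton] at hw
      obtain ⟨hwx, rfl | hvw⟩ := hw
      · exact hvK
      · refine (mem_badComps.1 hK).1.closed v hvK w ?_ hvw
        simp only [mem_compl, mem_nbhd_singleton, not_or]
        have hwC : w ∉ ({a, c, b, d} : Finset V) := fun hw =>
          ((mem_badComps.1 hC).1.not_adj hw).2 hvw
        refine ⟨fun e => hva.2 (e ▸ hvw), fun haw => ?_⟩
        have hdN := h.card_nbhd_le hC haC
        obtain ⟨hac, hab, had, hcb, hcd, hbd⟩ := hd
        simp only [mem_insert, mem_singleton, not_or] at hwC hx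
        exact hwx (eq_of_adj_of_card_le hdN hac hab had ⟨hcb.ne, hcd.ne, hbd⟩ haw hax hwC.2 hx.2)
    have hKeq := eq_of_subset_of_card_le hsub (by
      rw [(h.bad4 hK).card, card_erase_of_mem (mem_nbhd_singleton.2 (.inr hvx))]
      omega)
    have hKv : ∀ u ∈ K, u ≠ v → G.Adj v u := by
      intro u hu huv
      rw [← hKeq, mem_erase, mem_nbhd_singleton] at hu
      exact hu.2.resolve_left huv.symm
    obtain ⟨p, q, r, s, hQ, rfl⟩ := h.bad4 hK
    have hrs := h.not_adj_of_dia hQ hK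
    have hvp : v = p ∨ v = q := by
      simp only [mem_insert, mem_singleton] at hvK
      rcases hvK with e | e | e | e
      · exact .inl e
      · exact .inr e
      · exact absurd (e ▸ hKv s (by simp) (e ▸ hQ.2.2.2.2.2.symm)) hrs
      · exact absurd (e ▸ hKv r (by simp) (e ▸ hQ.2.2.2.2.2)).symm hrs
    rcases hvp with rfl | rfl
    · exact Config.false ⟨hK, hC, hQ, hd, hvx, hax⟩ h
    · exact Config.false ⟨Finset.insert_comm p v _ ▸ hK, hC, hQ.swap, hd, hvx, hax⟩ h
  obtain ⟨x, hx, hax | hcx⟩ := h.exists_adj_center hd₀ hC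
  · exact key a₀ c₀ hd₀ hC x hx hax
  · exact key c₀ a₀ hd₀.swap (by rwa [Finset.insert_comm]) x (by rwa [Finset.insert_comm]) hcx

/-- If `c` has three given neighbours, these are all of its neighbours. -/
lemma mem_of_adj (h : MinCounter G) {c p₁ p₂ p₃ w : V} (h₁ : G.Adj c p₁) (h₂ : G.Adj c p₂)
    (h₃ : G.Adj c p₃) (hne : p₁ ≠ p₂ ∧ p₁ ≠ p₃ ∧ p₂ ≠ p₃) (hw : G.Adj c w) :
    w = p₁ ∨ w = p₂ ∨ w = p₃ := by
  by_contra! hn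
  have := five_le_card_nbhd h₁ h₂ h₃ hw
    ⟨hne.1, hne.2.1, hn.1.symm, hne.2.2, hn.2.1.symm, hn.2.2.symm⟩
  have := h.card_nbhd_le_four c
  omega

lemma false (h : MinCounter G) : False := by
  obtain ⟨a, c, b, d, hd⟩ : ∃ a c b d, Dia G a c b d := by
    by_contra! hn
    have := h.big ∅ (fun p q r s hQ => absurd hQ (hn p q r s))
    simp at this
  obtain ⟨u, hu, x, hx, hux⟩ : ∃ u ∈ ({a, c, b, d} : Finset V), ∃ x ∉ ({a, c, b, d} : Finset V),
      G.Adj u x := by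
    by_contra! hn
    refine h.notBad (.inl ⟨a, c, b, d, hd, ?_⟩)
    refine (h.conn.2 _ (subset_univ _) ⟨a, by simp⟩ fun u hu w _ huw => ?_).symm
    by_contra hw
    exact hn u hu w hw huw
  have key : ∀ b d, Dia G a c b d → x ∉ ({a, c, b, d} : Finset V) → ¬ G.Adj b x := by
    intro b d hd hx hbx
    obtain ⟨hac, hab, had, hcb, hcd, hbd⟩ := id hd
    have hx' := hx
    simp only [mem_insert, mem_singleton, not_or] at hx'
    have hNa := fun w (hw : G.Adj a w) =>
      h.mem_of_adj hac hab had ⟨hcb.ne, hcd.ne, hbd⟩ hw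
    have hNc := fun w (hw : G.Adj c w) =>
      h.mem_of_adj hac.symm hcb hcd ⟨hab.ne, had.ne, hbd⟩ hw
    have hNb := fun w (hw : G.Adj b w) =>
      h.mem_of_adj hab.symm hcb.symm hbx ⟨hac.ne, Ne.symm hx'.1, Ne.symm hx'.2.1⟩ hw
    have hnb : ∀ {w}, ¬ G.Adj x w → w ≠ b := fun hw e => hw (e ▸ hbx.symm)
    have center : ∀ p q r s, Dia G p q r s → ¬ G.Adj x p → ¬ G.Adj x q → ¬ G.Adj x r →
        ¬ G.Adj x s → p ≠ a ∧ p ≠ c := by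
      intro p q r s hQ xp xq xr xs
      exact ⟨hQ.center_ne hNa (hnb xq) (hnb xr) (hnb xs),
        hQ.center_ne hNc (hnb xq) (hnb xr) (hnb xs)⟩
    have tip : ∀ p q r s, Dia G p q r s → ¬ G.Adj x p → ¬ G.Adj x q → ¬ G.Adj x r →
        ¬ G.Adj x s → r ≠ a ∧ r ≠ c := by
      intro p q r s hQ xp xq xr xs
      obtain ⟨pa, pc⟩ := center p q r s hQ xp xq xr xs
      obtain ⟨qa, qc⟩ := center q p r s hQ.swap xq xp xr xs
      exact ⟨hQ.tip_ne hNa (hnb xp) (hnb xq) pc qc, hQ.tip_ne hNc (hnb xp) (hnb xq) pa qa⟩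
    have hd_full : ∀ u w, u ≠ a ∧ u ≠ c → w ≠ a ∧ w ≠ c → u ≠ w → G.Adj d u → ¬ G.Adj d w := by
      rintro u w ⟨ua, uc⟩ ⟨wa, wc⟩ huw hdu hdw
      rcases h.mem_of_adj had.symm hcd.symm hdu ⟨hac.ne, ua.symm, uc.symm⟩ hdw with e | e | e
      exacts [wa e, wc e, huw e.symm]
    obtain ⟨M, hM, hMx⟩ := h.exists_unhit (x := x) hd.card hx (by
      intro p q r s hQ xp xq xr xs
      simp only [mem_nbhd_singleton, not_or] at xp xq xr xs
      have h₁ := center p q r s hQ xp.2 xq.2 xr.2 xs.2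
      have h₂ := center q p r s hQ.swap xq.2 xp.2 xr.2 xs.2
      have h₃ := tip p q r s hQ xp.2 xq.2 xr.2 xs.2
      have h₄ := tip p q s r hQ.swap' xp.2 xq.2 xs.2 xr.2
      obtain ⟨hpq, hpr, hps, hqr, hqs, hrs⟩ := hQ
      simp only [mem_insert, mem_singleton, not_or]
      exact ⟨⟨h₁.1, h₁.2, hnb xp.2, fun e => hd_full q r h₂ h₃ hqr.ne (e ▸ hpq) (e ▸ hpr)⟩,
        ⟨h₂.1, h₂.2, hnb xq.2, fun e => hd_full p r h₁ h₃ hpr.ne (e ▸ hpq.symm) (e ▸ hqr)⟩,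
        ⟨h₃.1, h₃.2, hnb xr.2, fun e => hd_full p q h₁ h₂ hpq.ne (e ▸ hpr.symm) (e ▸ hqr.symm)⟩,
        ⟨h₄.1, h₄.2, hnb xs.2, fun e => hd_full p q h₁ h₂ hpq.ne (e ▸ hps.symm) (e ▸ hqs.symm)⟩⟩)
    obtain ⟨hMc, hMb⟩ := mem_badComps.1 hM
    have hMn : ∀ m ∈ M, m ≠ x ∧ m ≠ a ∧ m ≠ c ∧ m ≠ b ∧ m ≠ d := fun m hm => by
      simpa using hMc.sub hm
    refine h.not_badComp_singleton d (C := M) (mem_badComps.2 ⟨⟨fun m hm => ?_, hMc.conn,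
      fun u hu w hw huw => hMc.closed u hu w ?_ huw⟩, hMb⟩)
    · simpa using (hMn m hm).2.2.2.2
    · obtain ⟨ux, ua, uc, ub, ud⟩ := hMn u hu
      rw [mem_compl, mem_singleton] at hw
      simp only [mem_compl, mem_insert, mem_singleton, not_or]
      refine ⟨?_, ?_, ?_, ?_, hw⟩ <;> rintro rfl
      · exact hMx u hu huw.symm
      · have := hNa u huw.symm; tauto
      · have := hNc u huw.symm; tauto
      · have := hNb u huw.symm; tauto
  obtain ⟨hac, hab, had, hcb, hcd, hbd⟩ := id hd
  have hx' := hx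
  simp only [mem_insert, mem_singleton, not_or] at hu hx'
  rcases hu with rfl | rfl | rfl | rfl
  · have := h.mem_of_adj hac hab had ⟨hcb.ne, hcd.ne, hbd⟩ hux
    tauto
  · have := h.mem_of_adj hac.symm hcb hcd ⟨hab.ne, had.ne, hbd⟩ hux
    tauto
  · exact key u d hd hx hux
  · exact key u b hd.swap' (by rwa [Finset.pair_comm]) hux

end MinCounter

lemma DiaFree.of_comap {W : Type*} [Fintype W] {e : W ↪ V} {D : Finset W}
    (h : DiaFree (G.comap e) (nbhd (G.comap e) D)ᶜ) :
    DiaFree G (univ.map e \ nbhd G (D.map e)) := by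
  intro p q r s hd hp hq hr hs
  have lift {x : V} (hx : x ∈ univ.map e \ nbhd G (D.map e)) :
      ∃ y ∈ (nbhd (G.comap e) D)ᶜ, e y = x := by
    obtain ⟨hx, hx'⟩ := mem_sdiff.1 hx
    obtain ⟨y, -, rfl⟩ := mem_map.1 hx
    refine ⟨y, mem_compl.2 fun hy => hx' ?_, rfl⟩
    obtain ⟨w, hw, hwy⟩ := mem_nbhd.1 hy
    exact mem_nbhd.2 ⟨e w, mem_map_of_mem e hw, hwy.imp_left (congrArg e)⟩
  obtain ⟨p, hp', rfl⟩ := lift hp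
  obtain ⟨q, hq', rfl⟩ := lift hq
  obtain ⟨r, hr', rfl⟩ := lift hr
  obtain ⟨s, hs', rfl⟩ := lift hs
  obtain ⟨h1, h2, h3, h4, h5, h6⟩ := hd
  exact h p q r s ⟨h1, h2, h3, h4, h5, fun hrs => h6 (congrArg e hrs)⟩ hp' hq' hr' hs'

/-- The bound for connected graphs that are not exceptional. -/
theorem exists_isolating {V : Type*} [Fintype V] (G : SimpleGraph V) (hG : Conn G univ)
    (hbad : ¬ Bad G univ) :
    ∃ D, 5 * #D ≤ Fintype.card V ∧ DiaFree G (nbhd G D)ᶜ := by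
  induction hn : Fintype.card V using Nat.strong_induction_on generalizing V with
  | _ n ih =>
    subst hn
    by_contra! hD
    refine MinCounter.false (G := G) ⟨hG, hbad, fun D hfree => ?_, fun T hT hconn hT' => ?_⟩
    · by_contra! hcard
      exact hD D hcard hfree
    · have hmap : univ.map (Function.Embedding.subtype (· ∈ T)) = T := by
        ext
        simp
      have hlt : Fintype.card {x // x ∈ T} < Fintype.card V := by
        rw [Fintype.card_coe]
        exact (card_lt_iff_ne_univ T).2 hT
      obtain ⟨D, hcard, hfree⟩ := ih _ hlt (G.comap (Function.Embedding.subtype (· ∈ T)))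
        (Conn.comap (by rwa [hmap])) (fun h => hT' (hmap ▸ h.of_comap)) rfl
      refine ⟨D.map (Function.Embedding.subtype (· ∈ T)), ?_, ?_⟩
      · rwa [card_map, ← Fintype.card_coe T]
      · simpa only [hmap] using hfree.of_comap

lemma conn_univ_of_connected (h : G.Connected) : Conn G univ := by
  have := h.nonempty
  refine ⟨univ_nonempty, fun A _ ⟨a, ha⟩ hcl => eq_univ_of_forall fun b => ?_⟩
  obtain ⟨p⟩ := h.preconnected a b
  induction p with
  | nil => exact ha
  | cons hadj _ ih => exact ih (hcl _ ha _ (mem_univ _) hadj)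

lemma Bad4.nonempty_iso (h : Bad4 G univ) :
    Nonempty (G ≃g diamondGraph) ∨ Nonempty (G ≃g K4) := by
  have hcard := h.card
  obtain ⟨p, q, r, s, ⟨h1, h2, h3, h4, h5, h6⟩, huniv⟩ := h
  have hbij : Function.Bijective ![p, r, q, s] := by
    refine (Fintype.bijective_iff_surjective_and_card _).2 ⟨fun x => ?_, ?_⟩
    · have hx : x ∈ ({p, q, r, s} : Finset V) := huniv ▸ mem_univ x
      simp only [mem_insert, mem_singleton] at hx
      obtain rfl | rfl | rfl | rfl := hx
      exacts [⟨0, rfl⟩, ⟨2, rfl⟩, ⟨1, rfl⟩, ⟨3, rfl⟩]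
    · rw [Fintype.card_fin, ← card_univ, hcard]
  by_cases hrs : G.Adj r s
  · refine .inr ⟨(RelIso.mk (Equiv.ofBijective _ hbij) fun {i j} => ?_ : K4 ≃g G).symm⟩
    fin_cases i <;> fin_cases j <;> simp [K4, h1, h2, h3, h4, h5, hrs, h1.symm, h2.symm, h3.symm,
      h4.symm, h5.symm, hrs.symm]
  · have hsr : ¬ G.Adj s r := fun h => hrs h.symm
    refine .inl ⟨(RelIso.mk (Equiv.ofBijective _ hbij) fun {i j} => ?_ : diamondGraph ≃g G).symm⟩
    fin_cases i <;> fin_cases j <;> simp [diamondGraph, h1, h2, h3, h4, h5, hrs, h1.symm, h2.symm,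
      h3.symm, h4.symm, h5.symm, hsr]

lemma Bad9.nonempty_iso (h : Bad9 G univ) : Nonempty (G ≃g Gr1) := by
  obtain ⟨φ, hφ, hadj, huniv⟩ := h
  have hsurj : Function.Surjective φ := fun x => by
    simpa using huniv.subset (mem_univ x)
  exact ⟨(RelIso.mk (Equiv.ofBijective φ ⟨hφ, hsurj⟩) fun {i j} =>
    (hadj i j).trans (gr1_adj i j).symm : Gr1 ≃g G).symm⟩

lemma DiaFree.isIsolating {D : Finset V} (h : DiaFree G (nbhd G D)ᶜ) :
    IsIsolating diamondGraph G (D : Set V) := by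
  rintro ⟨f, hf⟩
  have hmem (i : Fin 4) : (f i : V) ∈ (nbhd G D)ᶜ := by
    rw [mem_compl, mem_nbhd]
    rintro ⟨w, hw, hwi⟩
    refine (f i).2 ?_
    obtain rfl | hadj := hwi
    exacts [.inl hw, .inr ⟨w, hw, hadj⟩]
  refine h (f 0) (f 2) (f 1) (f 3) ⟨?_, ?_, ?_, ?_, ?_, ?_⟩ (hmem 0) (hmem 2) (hmem 1) (hmem 3)
  · exact hf (a := 0) (b := 2) (by simp [diamondGraph])
  · exact hf (a := 0) (b := 1) (by simp [diamondGraph])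
  · exact hf (a := 0) (b := 3) (by simp [diamondGraph])
  · exact hf (a := 2) (b := 1) (by simp [diamondGraph])
  · exact hf (a := 2) (b := 3) (by simp [diamondGraph])
  · exact fun h => absurd (f.injective (Subtype.ext h)) (by decide)

end DiamondIsolation

/-- If `G` is a connected `n`-vertex graph not isomorphic to the diamond, `K₄`, or `G₁`,
then `ι(G, C₄') ≤ ⌊n/5⌋`. -/
theorem stmt16 {V : Type*} [Fintype V] (G : SimpleGraph V) (hG : G.Connected)
    (h1 : ¬ Nonempty (G ≃g diamondGraph)) (h2 : ¬ Nonempty (G ≃g K4))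
    (h3 : ¬ Nonempty (G ≃g Gr1)) :
    isolNum diamondGraph G ≤ Fintype.card V / 5 := by
  have hbad : ¬ DiamondIsolation.Bad G Finset.univ := fun h => h.elim
    (fun h => h.nonempty_iso.elim h1 h2) fun h => h3 h.nonempty_iso
  obtain ⟨D, hcard, hfree⟩ := DiamondIsolation.exists_isolating G
    (DiamondIsolation.conn_univ_of_connected hG) hbad
  calc isolNum diamondGraph G ≤ D.card :=
        Nat.sInf_le ⟨D, Set.ncard_coe_finset D, hfree.isIsolating⟩
    _ ≤ Fintype.card V / 5 := by omega
end

section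
/- If G is a connected graph on n vertices that is not a triangle (i.e., not isomorphic to C_3), then there exists a set D ⊆ V(G) with |D| ≤ ⌊n/4⌋ such that the graph G − N[D], obtained by deleting the closed neighbourhood of D, contains no cycle. -/
open SimpleGraph

/-- `T` is the vertex set of a triangle component of `G[S]`. -/
def IsTriangleComp {V : Type*} (G : SimpleGraph V) (S T : Finset V) : Prop :=
  T ⊆ S ∧ T.card = 3 ∧ (∀ a ∈ T, ∀ b ∈ T, a ≠ b → G.Adj a b) ∧
    ∀ a ∈ T, ∀ b ∈ S, G.Adj a b → b ∈ T

open scoped Classical in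
/-- The triangle components of `G[S]`. -/
noncomputable def triangleComps {V : Type*} (G : SimpleGraph V) (S : Finset V) :
    Finset (Finset V) :=
  S.powerset.filter (IsTriangleComp G S)

/-- Every vertex of `U` has at least two neighbours in `U`. -/
def IsCore {V : Type*} (G : SimpleGraph V) (U : Finset V) : Prop :=
  ∀ u ∈ U, ∀ w, ∃ x ∈ U, G.Adj u x ∧ x ≠ w

/-- `U` is disjoint from the closed neighbourhood of `D`. -/
def Avoids {V : Type*} (G : SimpleGraph V) (U D : Finset V) : Prop :=
  ∀ u ∈ U, ∀ d ∈ D, u ≠ d ∧ ¬ G.Adj d u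

/-- `G[S]` has a cycle-isolating set of size at most `(|S| + t) / 4`, where `t` is the number of
triangle components of `G[S]`. -/
def HasSmallIsolatingSet {V : Type*} (G : SimpleGraph V) (S : Finset V) : Prop :=
  ∃ D : Finset V, 4 * D.card ≤ S.card + (triangleComps G S).card ∧
    ∀ U ⊆ S, IsCore G U → Avoids G U D → U = ∅

open scoped Classical in
/-- No part `X` of `S` can be removed at the price of putting `D` into the isolating set. -/
def IsIncompressible {V : Type*} (G : SimpleGraph V) (S : Finset V) : Prop :=
  ∀ D X : Finset V, X ⊆ S → X.Nonempty →
    (∀ U ⊆ S, IsCore G U → Avoids G U D → Disjoint U X) →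
    X.card + (triangleComps G S).card < 4 * D.card + (triangleComps G (S \ X)).card

section
open scoped Classical

variable {V : Type*} {G : SimpleGraph V} {S : Finset V}

lemma mem_triangleComps {T : Finset V} : T ∈ triangleComps G S ↔ IsTriangleComp G S T := by
  unfold triangleComps
  simp only [Finset.mem_filter, Finset.mem_powerset, and_iff_right_iff_imp]
  exact fun h => h.1

lemma IsTriangleComp.nonempty {T : Finset V} (h : IsTriangleComp G S T) : T.Nonempty :=
  Finset.card_pos.1 (by rw [h.2.1]; norm_num)

/-- Deleting some triangle components creates no new ones. -/
lemma IsTriangleComp.of_sdiff_biUnion {C : Finset (Finset V)} {T : Finset V}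
    (hC : ∀ T' ∈ C, IsTriangleComp G S T') (hT : IsTriangleComp G (S \ C.biUnion id) T) :
    IsTriangleComp G S T ∧ T ∉ C := by
  have hmem : ∀ u ∈ T, u ∈ S ∧ ∀ T' ∈ C, u ∉ T' := by
    intro u hu
    have := hT.1 hu
    simp only [Finset.mem_sdiff, Finset.mem_biUnion, id] at this
    exact ⟨this.1, fun T' h h' => this.2 ⟨T', h, h'⟩⟩
  refine ⟨⟨fun a ha => (hmem a ha).1, hT.2.1, hT.2.2.1, fun a ha b hb hab => ?_⟩, fun h => ?_⟩
  · refine hT.2.2.2 a ha b ?_ hab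
    simp only [Finset.mem_sdiff, Finset.mem_biUnion, id]
    refine ⟨hb, ?_⟩
    rintro ⟨T', hT', hbT'⟩
    exact (hmem a ha).2 T' hT' ((hC T' hT').2.2.2 b hbT' a (hmem a ha).1 hab.symm)
  · obtain ⟨a, ha⟩ := hT.nonempty
    exact (hmem a ha).2 T h ha

lemma IsTriangleComp.of_sdiff {T T' : Finset V} (h : IsTriangleComp G S T)
    (h' : IsTriangleComp G (S \ T) T') : IsTriangleComp G S T' ∧ T' ≠ T := by
  have hres := of_sdiff_biUnion (C := {T}) (T := T') (by simpa using h) (by simpa using h')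
  simpa using hres

/-- Two triangle components that share a vertex are equal. -/
lemma IsTriangleComp.eq_of_mem {T T' : Finset V} (h : IsTriangleComp G S T)
    (h' : IsTriangleComp G S T') {a : V} (ha : a ∈ T) (ha' : a ∈ T') : T = T' := by
  refine Finset.eq_of_subset_of_card_le (fun b hb => ?_) (by rw [h.2.1, h'.2.1])
  by_cases hab : a = b
  · exact hab ▸ ha'
  · exact h'.2.2.2 a ha' b (h.1 hb) (h.2.2.1 a ha b hb hab)

/-- If `w` is removed from a triangle component `T`, no core meets what is left. -/
lemma IsTriangleComp.notMem_core {T U : Finset V} (h : IsTriangleComp G S T) {w u : V}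
    (hw : w ∈ T) (hU : IsCore G U) (hwU : w ∉ U)
    (hUS : ∀ x ∈ U, u ∈ T → G.Adj u x → x ∈ S) (hu : u ∈ U) : u ∉ T := by
  intro huT
  have hc : ((T.erase w).erase u).card = 1 := by
    have : u ≠ w := fun e => hwU (e ▸ hu)
    rw [Finset.card_erase_of_mem (Finset.mem_erase.2 ⟨this, huT⟩), Finset.card_erase_of_mem hw,
      h.2.1]
  obtain ⟨z, hz⟩ := Finset.card_eq_one.1 hc
  obtain ⟨x, hx, hux, hxz⟩ := hU u hu z
  have hxT := h.2.2.2 u huT x (hUS x hx huT hux) hux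
  have : x ∈ (T.erase w).erase u := by
    simp only [Finset.mem_erase]
    exact ⟨hux.ne', fun e => hwU (e ▸ hx), hxT⟩
  rw [hz] at this
  exact hxz (Finset.mem_singleton.1 this)

lemma IsIncompressible.not_isTriangleComp (hS : IsIncompressible G S) (T : Finset V) :
    ¬ IsTriangleComp G S T := by
  intro hT
  obtain ⟨a, ha⟩ : T.Nonempty := hT.nonempty
  have h := hS {a} T hT.1 ⟨a, ha⟩ (fun U hUS hU hUa => by
    have haU : a ∉ U := fun h => (hUa a h a (by simp)).1 rfl
    exact Finset.disjoint_left.2 fun u hu =>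
      hT.notMem_core ha hU haU (fun x hx _ _ => hUS hx) hu)
  have hsub : triangleComps G (S \ T) ⊆ (triangleComps G S).erase T := by
    intro T' hT'
    obtain ⟨h1, h2⟩ := hT.of_sdiff (mem_triangleComps.1 hT')
    exact Finset.mem_erase.2 ⟨h2, mem_triangleComps.2 h1⟩
  have h1 := Finset.card_le_card hsub
  have hmem := mem_triangleComps.2 hT
  rw [Finset.card_erase_of_mem hmem] at h1
  have := Finset.card_pos.2 ⟨T, hmem⟩
  rw [hT.2.1, Finset.card_singleton] at h
  omega

lemma IsIncompressible.triangleComps_eq_empty (hS : IsIncompressible G S) : triangleComps G S = ∅ :=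
  Finset.eq_empty_of_forall_notMem fun T hT =>
    hS.not_isTriangleComp T (mem_triangleComps.1 hT)

lemma IsIncompressible.card_lt (hS : IsIncompressible G S) (D X : Finset V) (hX : X ⊆ S)
    (hne : X.Nonempty) (hc : ∀ U ⊆ S, IsCore G U → Avoids G U D → ∀ u ∈ U, u ∉ X) :
    X.card < 4 * D.card + (triangleComps G (S \ X)).card := by
  have := hS D X hX hne fun U h1 h2 h3 => Finset.disjoint_left.2 (hc U h1 h2 h3)
  rwa [hS.triangleComps_eq_empty, Finset.card_empty, add_zero] at this

/-- A set `X` of at least four vertices all of whose vertices are handled by one vertex `x`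
leaves a triangle component behind. -/
lemma IsIncompressible.exists_isTriangleComp (hS : IsIncompressible G S) (x : V) (X : Finset V)
    (hX : X ⊆ S) (h4 : 4 ≤ X.card)
    (hc : ∀ U ⊆ S, IsCore G U → x ∉ U → (∀ u ∈ U, ¬ G.Adj x u) → ∀ u ∈ U, u ∉ X) :
    ∃ T, IsTriangleComp G (S \ X) T := by
  by_contra! hno
  have h := hS.card_lt {x} X hX (Finset.card_pos.1 (by omega)) fun U h1 h2 h3 =>
    hc U h1 h2 (fun hx => (h3 x hx x (by simp)).1 rfl) (fun u hu => (h3 u hu x (by simp)).2)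
  have : triangleComps G (S \ X) = ∅ :=
    Finset.eq_empty_of_forall_notMem fun T hT => hno T (mem_triangleComps.1 hT)
  rw [this] at h
  simp at h
  omega

lemma IsIncompressible.not_isTriangleComp_sdiff_singleton (hS : IsIncompressible G S) {x : V}
    (hx : x ∈ S) (T : Finset V) : ¬ IsTriangleComp G (S \ {x}) T := by
  intro hT
  set B := (triangleComps G (S \ {x})).biUnion id with hB
  have hmemB : ∀ u, u ∈ B ↔ ∃ T', IsTriangleComp G (S \ {x}) T' ∧ u ∈ T' := by
    intro u
    simp [hB, mem_triangleComps]
  have hTB : T ⊆ B := fun u hu => (hmemB u).2 ⟨T, hT, hu⟩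
  have hBS : B ⊆ S \ {x} := by
    intro u hu
    obtain ⟨T', hT', hu⟩ := (hmemB u).1 hu
    exact hT'.1 hu
  have hxB : x ∉ B := fun h => by simpa using hBS h
  obtain ⟨T', hT'⟩ := hS.exists_isTriangleComp x (insert x B)
    (Finset.insert_subset hx (hBS.trans Finset.sdiff_subset))
    (by rw [Finset.card_insert_of_notMem hxB]; have := Finset.card_le_card hTB; rw [hT.2.1] at this
        omega) (by
      intro U hUS hU hxU hUx u hu huX
      rcases Finset.mem_insert.1 huX with rfl | huB
      · exact hxU hu
      obtain ⟨T', hT', huT'⟩ := (hmemB u).1 huB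
      have : ∃ w ∈ T', G.Adj x w := by
        by_contra! hno
        refine hS.not_isTriangleComp T' ⟨hT'.1.trans Finset.sdiff_subset, hT'.2.1, hT'.2.2.1, ?_⟩
        intro a ha b hb hab
        refine hT'.2.2.2 a ha b (Finset.mem_sdiff.2 ⟨hb, ?_⟩) hab
        rw [Finset.mem_singleton]
        rintro rfl
        exact hno a ha hab.symm
      obtain ⟨w, hw, hxw⟩ := this
      refine hT'.notMem_core hw hU (fun h => hUx w h hxw) ?_ hu huT'
      intro y hy _ _
      refine Finset.mem_sdiff.2 ⟨hUS hy, ?_⟩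
      rw [Finset.mem_singleton]
      rintro rfl
      exact hxU hy)
  rw [Finset.insert_eq, ← Finset.sup_eq_union, ← sdiff_sdiff_left] at hT'
  obtain ⟨h1, h2⟩ := IsTriangleComp.of_sdiff_biUnion (fun T => mem_triangleComps.1) hT'
  exact h2 (mem_triangleComps.2 h1)

/-- Any triangle component left after deleting `X` is joined to at least two vertices of `X`. -/
lemma IsIncompressible.exists_link (hS : IsIncompressible G S) {X T : Finset V} (hX : X ⊆ S)
    (hT : IsTriangleComp G (S \ X) T) (y : V) : ∃ z ∈ X, z ≠ y ∧ ∃ a ∈ T, G.Adj z a := by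
  by_contra! hno
  by_cases hy : y ∈ X
  · refine hS.not_isTriangleComp_sdiff_singleton (hX hy) T
      ⟨hT.1.trans (by intro u; simp; grind), hT.2.1, hT.2.2.1, ?_⟩
    intro a ha b hb hab
    simp at hb
    by_cases hbX : b ∈ X
    · exact absurd hab.symm (hno b hbX hb.2 a ha)
    · exact hT.2.2.2 a ha b (by simp; tauto) hab
  · refine hS.not_isTriangleComp T ⟨hT.1.trans Finset.sdiff_subset, hT.2.1, hT.2.2.1, ?_⟩
    intro a ha b hb hab
    by_cases hbX : b ∈ X
    · exact absurd hab.symm (hno b hbX (by rintro rfl; exact hy hbX) a ha)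
    · exact hT.2.2.2 a ha b (by simp; tauto) hab

lemma IsTriangleComp.exists_others {T : Finset V} (h : IsTriangleComp G S T) {a : V} (ha : a ∈ T) :
    ∃ b ∈ T, ∃ c ∈ T, G.Adj a b ∧ G.Adj a c ∧ G.Adj b c ∧ ∀ x ∈ T, x = a ∨ x = b ∨ x = c := by
  have hc : (T.erase a).card = 2 := by rw [Finset.card_erase_of_mem ha, h.2.1]
  obtain ⟨b, c, hbc, he⟩ := Finset.card_eq_two.1 hc
  have hb : b ∈ T.erase a := by simp [he]
  have hc : c ∈ T.erase a := by simp [he]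
  rw [Finset.mem_erase] at hb hc
  refine ⟨b, hb.2, c, hc.2, h.2.2.1 a ha b hb.2 hb.1.symm, h.2.2.1 a ha c hc.2 hc.1.symm,
    h.2.2.1 b hb.2 c hc.2 hbc, fun x hx => ?_⟩
  by_cases hxa : x = a
  · exact Or.inl hxa
  · have : x ∈ T.erase a := Finset.mem_erase.2 ⟨hxa, hx⟩
    rw [he] at this
    simpa using Or.inr this

/-- In an incompressible set some vertex has at least three neighbours. -/
lemma IsIncompressible.exists_three_le_card (hS : IsIncompressible G S) (hne : S.Nonempty) :
    ∃ v ∈ S, 3 ≤ (S.filter (G.Adj v)).card := by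
  by_contra! hdeg
  have hthree : ∀ v ∈ S, ∀ a ∈ S, ∀ b ∈ S, ∀ c ∈ S, G.Adj v a → G.Adj v b → G.Adj v c →
      a ≠ b → a ≠ c → b ≠ c → False := by
    intro v hv a ha b hb c hc hva hvb hvc hab hac hbc
    have hsub : {a, b, c} ⊆ S.filter (G.Adj v) := by
      intro x hx
      simp only [Finset.mem_insert, Finset.mem_singleton, Finset.mem_filter] at hx ⊢
      rcases hx with rfl | rfl | rfl <;> tauto
    have := Finset.card_le_card hsub
    rw [Finset.card_eq_three.2 ⟨a, b, c, hab, hac, hbc, rfl⟩] at this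
    exact absurd (hdeg v hv) (by omega)
  have hfree : ∀ X T, X ⊆ S → ¬ IsTriangleComp G (S \ X) T := by
    intro X T hX hT
    obtain ⟨y, -⟩ := hne
    obtain ⟨z, hz, -, a, ha, hza⟩ := hS.exists_link hX hT y
    obtain ⟨b, hb, c, hc, hab, hac, hbc, -⟩ := hT.exists_others ha
    have hTX : ∀ x ∈ T, x ∈ S ∧ x ∉ X := fun x hx => Finset.mem_sdiff.1 (hT.1 hx)
    exact hthree a (hTX a ha).1 z (hX hz) b (hTX b hb).1 c (hTX c hc).1 hza.symm hab hac
      (fun e => (hTX b hb).2 (e ▸ hz)) (fun e => (hTX c hc).2 (e ▸ hz)) hbc.ne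
  have hcore : IsCore G S := by
    intro u hu w
    by_contra! hno
    have h := hS.card_lt ∅ {u} (by simpa using hu) (by simp) (by
      intro U hUS hU _ u' hu' h
      rw [Finset.mem_singleton] at h
      subst h
      obtain ⟨x, hx, hux, hxw⟩ := hU u' hu' w
      exact hxw (hno x (hUS hx) hux))
    rw [Finset.eq_empty_of_forall_notMem (s := triangleComps G (S \ {u})) fun T hT =>
      hfree {u} T (by simpa using hu) (mem_triangleComps.1 hT)] at h
    simp at h
  obtain ⟨v, hv⟩ := hne
  obtain ⟨a, ha, hva, -⟩ := hcore v hv v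
  obtain ⟨b, hb, hvb, hba⟩ := hcore v hv a
  obtain ⟨c, hc, hbc, hcv⟩ := hcore b hb v
  have hca : c ≠ a := by
    rintro rfl
    refine hS.not_isTriangleComp {v, c, b} ⟨?_, ?_, ?_, ?_⟩
    · intro x
      simp only [Finset.mem_insert, Finset.mem_singleton]
      rintro (rfl | rfl | rfl) <;> assumption
    · exact Finset.card_eq_three.2 ⟨v, c, b, hva.ne, hvb.ne, hba.symm, rfl⟩
    · have := hva.symm
      have := hvb.symm
      have := hbc.symm
      simp only [Finset.mem_insert, Finset.mem_singleton]
      rintro x (rfl | rfl | rfl) y (rfl | rfl | rfl) <;> tauto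
    · have := hva.symm
      have := hvb.symm
      have := hbc.symm
      simp only [Finset.mem_insert, Finset.mem_singleton]
      rintro x (rfl | rfl | rfl) y hy hxy <;> by_contra! hno
      · exact hthree x hv y hy c hc b hb hxy hva hvb hno.2.1 hno.2.2 hba.symm
      · exact hthree x ha y hy v hv b hb hxy hva.symm hbc.symm hno.1 hno.2.2 hvb.ne
      · exact hthree x hb y hy v hv c hc hxy hvb.symm hbc hno.1 hno.2.1 hva.ne
  have hX : {a, v, b, c} ⊆ S := by
    intro x
    simp only [Finset.mem_insert, Finset.mem_singleton]
    rintro (rfl | rfl | rfl | rfl) <;> assumption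
  obtain ⟨T, hT⟩ := hS.exists_isTriangleComp v {a, v, b, c} hX
    (by
      have := hva.ne
      have := hvb.ne
      have := hbc.ne
      rw [Finset.card_insert_of_notMem, Finset.card_insert_of_notMem,
        Finset.card_insert_of_notMem, Finset.card_singleton] <;> simp <;> grind) (by
      intro U hUS hU hvU hvU' u hu huX
      simp only [Finset.mem_insert, Finset.mem_singleton] at huX
      rcases huX with rfl | rfl | rfl | rfl
      · exact hvU' u hu hva
      · exact hvU hu
      · exact hvU' u hu hvb
      · obtain ⟨x, hx, hux, hxb⟩ := hU u hu b
        obtain ⟨y, hy, huy, hyx⟩ := hU u hu x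
        exact hthree u hc x (hUS hx) y (hUS hy) b hb hux huy hbc.symm hyx.symm hxb
          (by rintro rfl; exact hvU' y hy hvb))
  exact hfree _ T hX hT

/-- A covering estimate for incidence relations in which every block has at least two points. -/
lemma card_bounds_of_cover {α β : Type*} (N : Finset α) (B : Finset β) (R : α → β → Prop)
    (h2 : ∀ b ∈ B, 2 ≤ (N.filter (R · b)).card)
    (hQ : ∀ Q ⊆ N, N.card + 4 * (B.filter fun b => ∃ q ∈ Q, R q b).card < 3 + 4 * Q.card + B.card) :
    (∀ y ∈ N, (B.filter (R y)).card ≤ 1) ∧ N.card ≤ B.card + 2 ∧ 2 * B.card ≤ N.card := by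
  set c : Finset α → Finset β := fun Q => B.filter fun b => ∃ q ∈ Q, R q b with hc
  obtain ⟨Q, hQm, hmax⟩ := Finset.exists_max_image
    (N.powerset.filter fun Q => 2 * Q.card ≤ (c Q).card) Finset.card ⟨∅, by simp [hc]⟩
  simp only [Finset.mem_filter, Finset.mem_powerset] at hQm hmax
  obtain ⟨hQN, hQc⟩ := hQm
  have hone : ∀ y ∈ N \ Q, ((B \ c Q).filter (R y)).card ≤ 1 := by
    intro y hy
    by_contra! hlt
    rw [Finset.mem_sdiff] at hy
    have hsub : c Q ∪ (B \ c Q).filter (R y) ⊆ c (insert y Q) := by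
      intro b hb
      simp only [hc, Finset.mem_union, Finset.mem_filter, Finset.mem_sdiff,
        Finset.mem_insert] at hb ⊢
      grind
    have hdisj : Disjoint (c Q) ((B \ c Q).filter (R y)) := by
      rw [Finset.disjoint_left]
      intro b hb hb'
      simp only [Finset.mem_filter, Finset.mem_sdiff] at hb'
      exact hb'.1.2 hb
    have h1 := Finset.card_le_card hsub
    rw [Finset.card_union_of_disjoint hdisj] at h1
    have h3 := hmax (insert y Q) ⟨Finset.insert_subset hy.1 hQN, by
      rw [Finset.card_insert_of_notMem hy.2]; omega⟩
    rw [Finset.card_insert_of_notMem hy.2] at h3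
    omega
  have hcount : (B \ c Q).card * 2 ≤ (N \ Q).card * 1 := by
    refine Finset.card_mul_le_card_mul (fun b y => R y b) ?_ ?_
    · intro b hb
      rw [Finset.mem_sdiff] at hb
      refine (h2 b hb.1).trans (Finset.card_le_card ?_)
      intro y hy
      simp only [Finset.bipartiteAbove, Finset.mem_filter, Finset.mem_sdiff] at hy ⊢
      refine ⟨⟨hy.1, fun hyQ => hb.2 ?_⟩, hy.2⟩
      simp only [hc, Finset.mem_filter]
      exact ⟨hb.1, y, hyQ, hy.2⟩
    · intro y hy
      exact hone y hy
  have hcB : c Q ⊆ B := Finset.filter_subset _ _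
  rw [Finset.card_sdiff_of_subset hcB, Finset.card_sdiff_of_subset hQN] at hcount
  have h1 := Finset.card_le_card hcB
  have h3 := Finset.card_le_card hQN
  have h4 := hQ Q hQN
  change N.card + 4 * (c Q).card < _ at h4
  have hQ0 : Q = ∅ := Finset.card_eq_zero.1 (by omega)
  have hc0 : c Q = ∅ := by simp [hc, hQ0]
  rw [hQ0] at hone
  rw [hc0, hQ0] at hcount h4
  rw [hQ0] at hc0
  simp [hc0] at hone hcount h4
  exact ⟨hone, by omega, by omega⟩

/-- In an incompressible set, a triangle component of `G - N[v]` that is joined to only two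
neighbours of `v` cannot exist if one of them sees enough of the triangle. -/
lemma IsIncompressible.false_of_two_links (hS : IsIncompressible G S) {v x₁ x₂ : V} {T : Finset V}
    (hv : v ∈ S) (hx₁ : x₁ ∈ S) (hvx₁ : G.Adj v x₁)
    (hT : IsTriangleComp G (S \ insert v (S.filter (G.Adj v))) T)
    (hlink : ∀ y ∈ S, G.Adj v y → ∀ a ∈ T, G.Adj y a → y = x₁ ∨ y = x₂)
    (hx₁T : ∃ a ∈ T, G.Adj x₁ a)
    (hsees : ∀ b ∈ T, ∀ c ∈ T, b ≠ c → ¬ G.Adj x₁ b → ¬ G.Adj x₁ c → G.Adj x₂ b → ¬ G.Adj x₂ c) :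
    False := by
  have hTN : ∀ u ∈ T, u ∈ S ∧ u ≠ v ∧ ¬ G.Adj v u := by
    intro u hu
    have := hT.1 hu
    simp only [Finset.mem_sdiff, Finset.mem_insert, Finset.mem_filter] at this
    tauto
  have hnbr : ∀ u ∈ T, ∀ y ∈ S, G.Adj u y → y ∈ T ∨ y = x₁ ∨ y = x₂ := by
    intro u hu y hy huy
    by_cases hvy : G.Adj v y
    · exact Or.inr (hlink y hy hvy u hu huy.symm)
    · refine Or.inl (hT.2.2.2 u hu y ?_ huy)
      simp only [Finset.mem_sdiff, Finset.mem_insert, Finset.mem_filter]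
      refine ⟨hy, ?_⟩
      rintro (rfl | h)
      · exact (hTN u hu).2.2 huy.symm
      · exact hvy h.2
  have hcore : ∀ U ⊆ S, IsCore G U → x₁ ∉ U → (∀ u ∈ U, ¬ G.Adj x₁ u) → ∀ u ∈ U, u ∉ T := by
    intro U hUS hU hx₁U hUx u hu huT
    obtain ⟨a, haT, hxa⟩ := hx₁T
    have haU : a ∉ U := fun h => hUx a h hxa
    obtain ⟨b, hb, c, hc, hab, hac, hbc, hall⟩ := hT.exists_others haT
    have hstep : ∀ p ∈ T, ∀ q ∈ T, p ≠ q → p ≠ a → q ≠ a → p ∈ U → q ∈ U ∧ G.Adj x₂ p := by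
      intro p hp q hq hpq hpa hqa hpU
      obtain ⟨x, hx, hpx, hxq⟩ := hU p hpU q
      obtain ⟨y, hy, hpy, hyx⟩ := hU p hpU x₂
      have h1 := hnbr p hp x (hUS hx) hpx
      have h2 := hnbr p hp y (hUS hy) hpy
      have h3 := hpx.ne
      have h4 := hpy.ne
      have h5 := hpx.symm
      clear hlink hsees hTN hnbr hT hU
      grind
    have h1 := hab.ne
    have h2 := hac.ne
    have h3 := hbc.ne
    have hnb : b ∉ U := fun h => by
      obtain ⟨h4, h5⟩ := hstep b hb c hc h3 h1.symm h2.symm h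
      exact hsees b hb c hc h3 (hUx b h) (hUx c h4) h5
        (hstep c hc b hb h3.symm h2.symm h1.symm h4).2
    have hnc : c ∉ U := fun h => hnb (hstep c hc b hb h3.symm h2.symm h1.symm h).1
    rcases hall u huT with rfl | rfl | rfl <;> contradiction
  have hvT : v ∉ T := fun h => (hTN v h).2.1 rfl
  have hx₁nT : x₁ ∉ T := fun h => (hTN x₁ h).2.2 hvx₁
  have hXS : insert x₁ T ⊆ S := Finset.insert_subset hx₁ fun u hu => (hTN u hu).1
  have hXc : (insert x₁ T).card = 4 := by rw [Finset.card_insert_of_notMem hx₁nT, hT.2.1]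
  have hmem : ∀ T', IsTriangleComp G (S \ insert x₁ T) T' → v ∈ T' := by
    intro T' hT'
    by_contra hvT'
    have hvX : v ∈ S \ insert x₁ T := by
      have := hvx₁.ne
      simp only [Finset.mem_sdiff, Finset.mem_insert]
      tauto
    have hT'S : ∀ u ∈ T', u ∈ S ∧ u ≠ x₁ ∧ u ∉ T := by
      intro u hu
      have := hT'.1 hu
      simp only [Finset.mem_sdiff, Finset.mem_insert] at this
      tauto
    have hT'N : ∀ u ∈ T', ¬ G.Adj v u := fun u hu hvu => hvT' (hT'.2.2.2 u hu v hvX hvu.symm)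
    have hcomp : IsTriangleComp G (S \ insert v (S.filter (G.Adj v))) T' := by
      refine ⟨fun u hu => ?_, hT'.2.1, hT'.2.2.1, fun u hu y hy huy => ?_⟩
      · simp only [Finset.mem_sdiff, Finset.mem_insert, Finset.mem_filter]
        refine ⟨(hT'S u hu).1, ?_⟩
        rintro (rfl | h)
        · exact hvT' hu
        · exact hT'N u hu h.2
      · have huN : u ∈ S \ insert v (S.filter (G.Adj v)) := by
          simp only [Finset.mem_sdiff, Finset.mem_insert, Finset.mem_filter]
          refine ⟨(hT'S u hu).1, ?_⟩
          rintro (rfl | h)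
          · exact hvT' hu
          · exact hT'N u hu h.2
        refine hT'.2.2.2 u hu y ?_ huy
        have hyT : y ∉ T := fun h => (hT'S u hu).2.2 (hT.2.2.2 y h u huN huy.symm)
        simp only [Finset.mem_sdiff, Finset.mem_insert, Finset.mem_filter] at hy ⊢
        refine ⟨hy.1, ?_⟩
        rintro (rfl | h)
        · exact hy.2 (Or.inr ⟨hy.1, hvx₁⟩)
        · exact hyT h
    obtain ⟨z, hz, hzx, a, ha, hza⟩ := hS.exists_link
      (Finset.insert_subset hv (Finset.filter_subset _ _)) hcomp x₁
    simp only [Finset.mem_insert, Finset.mem_filter] at hz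
    rcases hz with rfl | ⟨hzS, hvz⟩
    · exact hT'N a ha hza
    · refine hT'N z (hT'.2.2.2 a ha z ?_ hza.symm) hvz
      simp only [Finset.mem_sdiff, Finset.mem_insert]
      refine ⟨hzS, ?_⟩
      rintro (h | h)
      · exact hzx h
      · exact (hTN z h).2.2 hvz
  obtain ⟨T', hT'⟩ := hS.exists_isTriangleComp x₁ (insert x₁ T) hXS hXc.ge (by
    intro U hUS hU hx₁U hUx u hu huX
    rcases Finset.mem_insert.1 huX with rfl | huT
    · exact hx₁U hu
    · exact hcore U hUS hU hx₁U hUx u hu huT)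
  have hT'S : T' ⊆ S := hT'.1.trans Finset.sdiff_subset
  obtain ⟨T₂, hT₂⟩ := hS.exists_isTriangleComp x₁ (insert x₁ T ∪ T') (Finset.union_subset hXS hT'S)
    (hXc.ge.trans (Finset.card_le_card Finset.subset_union_left)) (by
      intro U hUS hU hx₁U hUx u hu huX
      have hUT := hcore U hUS hU hx₁U hUx
      rcases Finset.mem_union.1 huX with huX | huT'
      · rcases Finset.mem_insert.1 huX with rfl | huT
        · exact hx₁U hu
        · exact hUT u hu huT
      · refine hT'.notMem_core (hmem T' hT') hU (fun h => hUx v h hvx₁.symm) ?_ hu huT'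
        intro x hx _ _
        simp only [Finset.mem_sdiff, Finset.mem_insert]
        refine ⟨hUS hx, ?_⟩
        rintro (rfl | h)
        · exact hx₁U hx
        · exact hUT x hx h)
  rw [← Finset.sup_eq_union, ← sdiff_sdiff_left] at hT₂
  have h := hmem T₂ (hT'.of_sdiff hT₂).1
  have hX := hmem T' hT'
  exact (Finset.mem_sdiff.1 (hT₂.1 h)).2 hX

/-- The vertex `v` has neighbours `x₁, x₂, x₃` in `S`, which are matched to the vertices of the
triangle `a b c`, and `v, a, b, c` have no further neighbours in `S`. -/
structure IsMatchedTriangle (G : SimpleGraph V) (S : Finset V) (v x₁ x₂ x₃ a b c : V) : Prop where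
  mem : v ∈ S ∧ x₁ ∈ S ∧ x₂ ∈ S ∧ x₃ ∈ S ∧ a ∈ S ∧ b ∈ S ∧ c ∈ S
  ne : x₁ ≠ x₂ ∧ x₁ ≠ x₃ ∧ x₂ ≠ x₃
  adj : G.Adj v x₁ ∧ G.Adj v x₂ ∧ G.Adj v x₃ ∧ G.Adj x₁ a ∧ G.Adj x₂ b ∧ G.Adj x₃ c ∧
    G.Adj a b ∧ G.Adj a c ∧ G.Adj b c
  not_adj : ¬ G.Adj v a ∧ ¬ G.Adj v b ∧ ¬ G.Adj v c
  adj_v : ∀ y ∈ S, G.Adj v y → y = x₁ ∨ y = x₂ ∨ y = x₃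
  adj_a : ∀ y ∈ S, G.Adj a y → y = b ∨ y = c ∨ y = x₁
  adj_b : ∀ y ∈ S, G.Adj b y → y = a ∨ y = c ∨ y = x₂
  adj_c : ∀ y ∈ S, G.Adj c y → y = a ∨ y = b ∨ y = x₃

lemma IsMatchedTriangle.swap {v x₁ x₂ x₃ a b c : V}
    (h : IsMatchedTriangle G S v x₁ x₂ x₃ a b c) : IsMatchedTriangle G S v x₁ x₃ x₂ a c b := by
  obtain ⟨h1, h2, h3, h4, h5, h6, h7, h8⟩ := h
  have := h3.2.2.2.2.2.2.2.2.symm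
  constructor <;> grind

lemma IsMatchedTriangle.swap' {v x₁ x₂ x₃ a b c : V}
    (h : IsMatchedTriangle G S v x₁ x₂ x₃ a b c) : IsMatchedTriangle G S v x₂ x₁ x₃ b a c := by
  obtain ⟨h1, h2, h3, h4, h5, h6, h7, h8⟩ := h
  have := h3.2.2.2.2.2.2.1.symm
  constructor <;> grind

lemma IsIncompressible.false_of_isMatchedTriangle (hS : IsIncompressible G S)
    {v x₁ x₂ x₃ a b c w : V} (h : IsMatchedTriangle G S v x₁ x₂ x₃ a b c)
    (hx₁ : ∀ y ∈ S, G.Adj x₁ y → y = v ∨ y = a ∨ y = w) (hwS : w ∈ S)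
    (hwne : w ≠ v ∧ w ≠ a ∧ w ≠ x₁ ∧ w ≠ b ∧ w ≠ c ∧ w ≠ x₃)
    (hw : G.Adj x₁ w ∨ ∃ p, G.Adj x₁ p ∧ ∃ q, ∀ y ∈ S, G.Adj w y → y = p ∨ y = q) : False := by
  obtain ⟨⟨hvS, hx₁S, hx₂S, hx₃S, haS, hbS, hcS⟩, ⟨h12, h13, h23⟩,
    ⟨hv1, hv2, hv3, h1a, h2b, h3c, hab, hac, hbc⟩, ⟨hva, hvb, hvc⟩, hv', ha', hb', hc'⟩ := h
  have hXS : {x₁, v, a, w} ⊆ S := by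
    intro x
    simp only [Finset.mem_insert, Finset.mem_singleton]
    rintro (rfl | rfl | rfl | rfl) <;> assumption
  obtain ⟨T, hT⟩ := hS.exists_isTriangleComp x₁ {x₁, v, a, w} hXS
    (by
      have := hv1.ne
      have := h1a.ne
      rw [Finset.card_insert_of_notMem, Finset.card_insert_of_notMem,
        Finset.card_insert_of_notMem, Finset.card_singleton] <;> simp <;> grind) (by
      intro U hUS hU hxU hxU' u hu huX
      simp only [Finset.mem_insert, Finset.mem_singleton] at huX
      rcases huX with rfl | rfl | rfl | rfl
      · exact hxU hu
      · exact hxU' u hu hv1.symm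
      · exact hxU' u hu h1a
      · rcases hw with hw | ⟨p, hp, q, hq⟩
        · exact hxU' u hu hw
        · obtain ⟨x, hx, hux, hxq⟩ := hU u hu q
          rcases hq x (hUS hx) hux with rfl | rfl
          · exact hxU' x hx hp
          · exact hxq rfl)
  have hTX : ∀ u ∈ T, u ∈ S ∧ u ≠ x₁ ∧ u ≠ v ∧ u ≠ a ∧ u ≠ w := by
    intro u hu
    have := hT.1 hu
    simp only [Finset.mem_sdiff, Finset.mem_insert, Finset.mem_singleton] at this
    tauto
  have hcl : ∀ u ∈ T, ∀ y ∈ S, G.Adj u y → y ≠ x₁ → y ≠ v → y ≠ a → y ≠ w → y ∈ T := by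
    intro u hu y hy huy h1 h2 h3 h4
    refine hT.2.2.2 u hu y ?_ huy
    simp only [Finset.mem_sdiff, Finset.mem_insert, Finset.mem_singleton]
    tauto
  have hb1 : b ≠ x₁ := by rintro rfl; exact hvb hv1
  have hc1 : c ≠ x₁ := by rintro rfl; exact hvc hv1
  have hb3 : b ≠ x₃ := by rintro rfl; exact hvb hv3
  have hbv : b ≠ v := by rintro rfl; exact hva (by grind [G.symm])
  have hcv : c ≠ v := by rintro rfl; exact hva hac.symm
  have h3a : x₃ ≠ a := by rintro rfl; exact hva hv3
  have hnc : c ∉ T := by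
    intro hc
    have h3T := hcl c hc x₃ hx₃S h3c.symm h13.symm hv3.ne' h3a hwne.2.2.2.2.2.symm
    have hbT := hcl c hc b hbS hbc.symm hb1 hbv hab.ne' hwne.2.2.2.1.symm
    have := hb' x₃ hx₃S (hT.2.2.1 b hbT x₃ h3T hb3)
    have := h3c.ne
    grind
  have hnb : b ∉ T := fun hb => hnc (hcl b hb c hcS hbc hc1 hcv hac.ne' hwne.2.2.2.2.1.symm)
  have hn2 : x₂ ∉ T := fun h => hnb (hcl x₂ h b hbS h2b hb1 hbv hab.ne' hwne.2.2.2.1.symm)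
  have hn3 : x₃ ∉ T := fun h => hnc (hcl x₃ h c hcS h3c hc1 hcv hac.ne' hwne.2.2.2.2.1.symm)
  obtain ⟨z, hz, hzw, u, hu, hzu⟩ := hS.exists_link hXS hT w
  have hu' := hTX u hu
  simp only [Finset.mem_insert, Finset.mem_singleton] at hz
  rcases hz with rfl | rfl | rfl | rfl
  · have := hx₁ u hu'.1 hzu
    tauto
  · have := hv' u hu'.1 hzu
    grind
  · have := ha' u hu'.1 hzu
    grind
  · exact hzw rfl

lemma eq_of_card_le_three {α : Type*} {F : Finset α} (hF : F.card ≤ 3) {p q r s : α} (hp : p ∈ F)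
    (hq : q ∈ F) (hr : r ∈ F) (hs : s ∈ F) (hpq : p ≠ q) (hpr : p ≠ r) (hqr : q ≠ r) :
    s = p ∨ s = q ∨ s = r := by
  have hsub : {p, q, r} ⊆ F := by
    intro x
    simp only [Finset.mem_insert, Finset.mem_singleton]
    rintro (rfl | rfl | rfl) <;> assumption
  have := Finset.eq_of_subset_of_card_le hsub (by
    rwa [Finset.card_eq_three.2 ⟨p, q, r, hpq, hpr, hqr, rfl⟩])
  rw [← this] at hs
  simpa using hs

/-- In an incompressible set of maximum degree three, no triangle component of `G - N[v]` is
joined to three neighbours of `v`. -/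
lemma IsIncompressible.not_isMatchedTriangle (hS : IsIncompressible G S)
    (hdeg : ∀ u ∈ S, (S.filter (G.Adj u)).card ≤ 3) {v x₁ x₂ x₃ a b c : V} :
    ¬ IsMatchedTriangle G S v x₁ x₂ x₃ a b c := by
  have hthird : ∀ {x₁ x₂ x₃ a b c : V}, IsMatchedTriangle G S v x₁ x₂ x₃ a b c →
      ∀ y ∈ S, G.Adj x₁ y → y = v ∨ y = a := by
    intro x₁ x₂ x₃ a b c h w hw h1w
    by_contra! hwne
    have hN : ∀ y ∈ S, G.Adj x₁ y → y = v ∨ y = a ∨ y = w := by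
      intro y hy h1y
      have h1 := h.mem
      have h2 := h.adj
      have h3 := h.not_adj
      refine eq_of_card_le_three (hdeg x₁ h1.2.1) (p := v) (q := a) (r := w) ?_ ?_ ?_ ?_ ?_
        hwne.1.symm hwne.2.symm
      · simpa using ⟨h1.1, h2.1.symm⟩
      · simpa using ⟨h1.2.2.2.2.1, h2.2.2.2.1⟩
      · simpa using ⟨hw, h1w⟩
      · simpa using ⟨hy, h1y⟩
      · rintro rfl
        exact h3.2.1 h2.2.2.2.2.2.2.1
    have hwb : w ≠ b := by
      rintro rfl
      have := h.adj_b x₁ h.mem.2.1 h1w.symm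
      have := h.ne
      have := h.adj.2.2.2.1.ne
      have := h.adj.1
      have := h.not_adj
      grind
    have hwc : w ≠ c := by
      rintro rfl
      have := h.adj_c x₁ h.mem.2.1 h1w.symm
      have := h.ne
      have := h.adj.2.2.2.1.ne
      have := h.adj.1
      have := h.not_adj
      grind
    by_cases hw3 : w = x₃
    · refine hS.false_of_isMatchedTriangle h.swap hN hw ⟨hwne.1, hwne.2, h1w.ne', hwc, hwb, ?_⟩
        (Or.inl h1w)
      rw [hw3]
      exact h.ne.2.2.symm
    · exact hS.false_of_isMatchedTriangle h hN hw ⟨hwne.1, hwne.2, h1w.ne', hwb, hwc, hw3⟩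
        (Or.inl h1w)
  intro h
  have h1 := hthird h
  have h2 := hthird h.swap'
  have h3 := h.not_adj
  have h4 := h.adj
  have h5 := h.ne
  refine hS.false_of_isMatchedTriangle h (w := x₂) (fun y hy hxy => ?_) h.mem.2.2.1 ⟨h4.2.1.ne', ?_,
    h5.1.symm, h4.2.2.2.2.1.ne, ?_, h5.2.2⟩ (Or.inr ⟨v, h4.1.symm, b, h2⟩)
  · have := h1 y hy hxy
    tauto
  · rintro rfl
    exact h3.1 h4.2.1
  · rintro rfl
    exact h3.2.2 h4.2.1

/-- The vertex `y` has a neighbour in `T`. -/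
def IsJoined (G : SimpleGraph V) (y : V) (T : Finset V) : Prop :=
  ∃ a ∈ T, G.Adj y a

/-- The triangle components of `G - N[v]` are few, and each neighbour of `v` is joined to at most
one of them. -/
lemma IsIncompressible.card_bounds (hS : IsIncompressible G S) {v : V} (hv : v ∈ S) {N : Finset V}
    (hN : N = S.filter (G.Adj v)) {B : Finset (Finset V)}
    (hB : B = triangleComps G (S \ insert v N)) :
    (∀ T ∈ B, 2 ≤ (N.filter fun y => IsJoined G y T).card) ∧
    (∀ y ∈ N, (B.filter fun T => IsJoined G y T).card ≤ 1) ∧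
      N.card ≤ B.card + 2 ∧ 2 * B.card ≤ N.card := by
  have hBT : ∀ T ∈ B, IsTriangleComp G (S \ insert v N) T := fun T hT =>
    mem_triangleComps.1 (hB ▸ hT)
  have hNS : insert v N ⊆ S := Finset.insert_subset hv (hN ▸ Finset.filter_subset _ _)
  have hvN : v ∉ N := by simp [hN]
  have hTN : ∀ T ∈ B, ∀ u ∈ T, u ∈ S ∧ u ≠ v ∧ u ∉ N := by
    intro T hT u hu
    have := (hBT T hT).1 hu
    simp only [Finset.mem_sdiff, Finset.mem_insert] at this
    tauto
  have hlink : ∀ T ∈ B, ∀ y, ∃ z ∈ N, z ≠ y ∧ IsJoined G z T := by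
    intro T hT y
    obtain ⟨z, hz, hzy, a, ha, hza⟩ := hS.exists_link hNS (hBT T hT) y
    rcases Finset.mem_insert.1 hz with rfl | hz
    · have := hTN T hT a ha
      simp only [hN, Finset.mem_filter] at this
      tauto
    · exact ⟨z, hz, hzy, a, ha, hza⟩
  have h2 : ∀ T ∈ B, 2 ≤ (N.filter fun y => IsJoined G y T).card := by
    intro T hT
    obtain ⟨z, hz, -, hza⟩ := hlink T hT v
    obtain ⟨w, hw, hwz, hwa⟩ := hlink T hT z
    exact Finset.one_lt_card.2 ⟨z, Finset.mem_filter.2 ⟨hz, hza⟩, w, Finset.mem_filter.2 ⟨hw, hwa⟩,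
      hwz.symm⟩
  refine ⟨h2, card_bounds_of_cover N B (IsJoined G) h2 ?_⟩
  intro Q hQN
  set C := B.filter fun T => ∃ q ∈ Q, IsJoined G q T with hC
  have hCB : C ⊆ B := Finset.filter_subset _ _
  have hdisj : Disjoint (insert v N) (C.biUnion id) := by
    rw [Finset.disjoint_left]
    intro u hu hu'
    simp only [Finset.mem_biUnion, id] at hu'
    obtain ⟨T, hT, huT⟩ := hu'
    have := hTN T (hCB hT) u huT
    rw [Finset.mem_insert] at hu
    tauto
  have hcard : (insert v N ∪ C.biUnion id).card = N.card + 1 + C.card * 3 := by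
    rw [Finset.card_union_of_disjoint hdisj, Finset.card_insert_of_notMem hvN,
      Finset.card_biUnion, Finset.sum_const_nat (m := 3)]
    · exact fun T hT => (hBT T (hCB hT)).2.1
    · intro T hT T' hT' hne
      exact Finset.disjoint_left.2 fun u hu hu' =>
        hne ((hBT T (hCB hT)).eq_of_mem (hBT T' (hCB hT')) hu hu')
  have hsub : triangleComps G (S \ (insert v N ∪ C.biUnion id)) ⊆ B \ C := by
    intro T hT
    rw [mem_triangleComps, ← Finset.sup_eq_union, ← sdiff_sdiff_left] at hT
    obtain ⟨h1, h3⟩ := IsTriangleComp.of_sdiff_biUnion (fun T hT => hBT T (hCB hT)) hT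
    exact Finset.mem_sdiff.2 ⟨hB ▸ mem_triangleComps.2 h1, h3⟩
  have hle := Finset.card_le_card hsub
  rw [Finset.card_sdiff_of_subset hCB] at hle
  have hCle := Finset.card_le_card hCB
  have hlt := hS.card_lt (insert v Q) (insert v N ∪ C.biUnion id) (by
    refine Finset.union_subset hNS fun u hu => ?_
    simp only [Finset.mem_biUnion, id] at hu
    obtain ⟨T, hT, huT⟩ := hu
    exact (hTN T (hCB hT) u huT).1) ⟨v, by simp⟩ (by
    intro U hUS hU hUa u hu huX
    have hNU : ∀ u ∈ U, u ∉ insert v N := by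
      intro u hu huN
      have := hUa u hu v (by simp)
      simp only [hN, Finset.mem_insert, Finset.mem_filter] at huN
      tauto
    rcases Finset.mem_union.1 huX with huX | huX
    · exact hNU u hu huX
    simp only [Finset.mem_biUnion, id] at huX
    obtain ⟨T, hT, huT⟩ := huX
    obtain ⟨hTB, q, hq, a, ha, hqa⟩ := Finset.mem_filter.1 hT
    exact (hBT T hTB).notMem_core ha hU
      (fun h => (hUa a h q (Finset.mem_insert_of_mem hq)).2 hqa)
      (fun x hx _ _ => Finset.mem_sdiff.2 ⟨hUS hx, hNU x hx⟩) hu huT)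
  rw [hcard, Finset.card_insert_of_notMem fun h => hvN (hQN h)] at hlt
  change N.card + 4 * C.card < _
  omega

/-- A nonempty vertex set is never incompressible. -/
lemma IsIncompressible.eq_empty (hS : IsIncompressible G S) : S = ∅ := by
  by_contra hne
  have hne := Finset.nonempty_iff_ne_empty.2 hne
  obtain ⟨v, hv, hmax⟩ := Finset.exists_max_image S (fun u => (S.filter (G.Adj u)).card) hne
  obtain ⟨u, hu, hu3⟩ := hS.exists_three_le_card hne
  have hv3 := hu3.trans (hmax u hu)
  set N := S.filter (G.Adj v) with hN
  set B := triangleComps G (S \ insert v N) with hB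
  obtain ⟨h2, h1, hb1, hb2⟩ := hS.card_bounds hv hN hB
  have hmemN : ∀ y, y ∈ N ↔ y ∈ S ∧ G.Adj v y := by simp [hN]
  obtain ⟨T, hTB⟩ : B.Nonempty := Finset.card_pos.1 (by omega)
  have hT : IsTriangleComp G (S \ insert v N) T := mem_triangleComps.1 hTB
  set L := N.filter fun y => IsJoined G y T with hL
  have hL2 : 2 ≤ L.card := h2 T hTB
  have hLN : L ⊆ N := Finset.filter_subset _ _
  have hmemL : ∀ y ∈ S, G.Adj v y → ∀ a ∈ T, G.Adj y a → y ∈ L := fun y hy hvy a ha hya =>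
    Finset.mem_filter.2 ⟨(hmemN y).2 ⟨hy, hvy⟩, a, ha, hya⟩
  have hdegree : L.card = 2 ∨ N.card = 3 ∧ L = N := by
    by_cases hBc : B.card = 1
    · rcases (show L.card = 2 ∨ 3 ≤ L.card by omega) with h | h
      · exact Or.inl h
      · exact Or.inr ⟨by omega, Finset.eq_of_subset_of_card_le hLN (by omega)⟩
    · left
      obtain ⟨T', hT', hne⟩ := Finset.exists_mem_ne (show 1 < B.card by omega) T
      have hd : Disjoint L (N.filter fun y => IsJoined G y T') := by
        rw [Finset.disjoint_left]
        intro y hy hy'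
        rw [hL, Finset.mem_filter] at hy
        rw [Finset.mem_filter] at hy'
        exact hne (Finset.card_le_one.1 (h1 y hy.1) T' (Finset.mem_filter.2 ⟨hT', hy'.2⟩) T
          (Finset.mem_filter.2 ⟨hTB, hy.2⟩))
      have := Finset.card_le_card (Finset.union_subset hLN (Finset.filter_subset
        (fun y => IsJoined G y T') N))
      rw [Finset.card_union_of_disjoint hd] at this
      have := h2 T' hT'
      omega
  rcases hdegree with hc | ⟨hN3, hLN⟩
  · obtain ⟨x₁, x₂, hx, hLx⟩ := Finset.card_eq_two.1 hc
    have hx₁ : x₁ ∈ L := by simp [hLx]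
    have hx₂ : x₂ ∈ L := by simp [hLx]
    rw [hL, Finset.mem_filter, hmemN] at hx₁ hx₂
    have hor : ∀ y ∈ S, G.Adj v y → ∀ a ∈ T, G.Adj y a → y = x₁ ∨ y = x₂ := by
      intro y hy hvy a ha hya
      simpa [hLx] using hmemL y hy hvy a ha hya
    by_cases hsees : ∀ b ∈ T, ∀ c ∈ T, b ≠ c → ¬ G.Adj x₁ b → ¬ G.Adj x₁ c → G.Adj x₂ b →
        ¬ G.Adj x₂ c
    · exact hS.false_of_two_links hv hx₁.1.1 hx₁.1.2 hT hor hx₁.2 hsees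
    · push Not at hsees
      obtain ⟨b, hb, c, hc, hbc, -, -, h3, h4⟩ := hsees
      obtain ⟨d, hd, e, he, hbd, hbe, hde, hall⟩ := hT.exists_others hb
      refine hS.false_of_two_links hv hx₂.1.1 hx₂.1.2 hT
        (fun y hy hvy a ha hya => (hor y hy hvy a ha hya).symm) hx₂.2 ?_
      intro p hp q hq hpq hp2 hq2
      have := hall p hp
      have := hall q hq
      have := hall c hc
      grind
  · have hdeg3 : ∀ u ∈ S, (S.filter (G.Adj u)).card ≤ 3 := fun u hu => hN3 ▸ hmax u hu
    obtain ⟨x₁, x₂, x₃, h12, h13, h23, hNx⟩ := Finset.card_eq_three.1 hN3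
    have hall : ∀ x ∈ N, x ∈ S ∧ G.Adj v x ∧ ∃ a ∈ T, G.Adj x a := by
      intro x hx
      refine ⟨((hmemN x).1 hx).1, ((hmemN x).1 hx).2, ?_⟩
      rw [← hLN, hL, Finset.mem_filter] at hx
      exact hx.2
    obtain ⟨hx₁, hv1, a, ha, h1a⟩ := hall x₁ (by simp [hNx])
    obtain ⟨hx₂, hv2, b, hb, h2b⟩ := hall x₂ (by simp [hNx])
    obtain ⟨hx₃, hv3, c, hc, h3c⟩ := hall x₃ (by simp [hNx])
    have hTN : ∀ u ∈ T, u ∈ S ∧ u ≠ v ∧ ¬ G.Adj v u := by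
      intro u hu
      have := hT.1 hu
      simp only [Finset.mem_sdiff, Finset.mem_insert, hmemN] at this
      tauto
    have hout : ∀ t ∈ T, ∀ x ∈ S, G.Adj v x → G.Adj x t → ∀ y ∈ S, G.Adj t y → y ∈ T ∨ y = x := by
      intro t ht x hx hvx hxt y hy hty
      obtain ⟨p, hp, q, hq, htp, htq, hpq, -⟩ := hT.exists_others ht
      have := eq_of_card_le_three (hdeg3 t (hTN t ht).1) (p := p) (q := q) (r := x) (s := y)
        (by simpa using ⟨(hTN p hp).1, htp⟩) (by simpa using ⟨(hTN q hq).1, htq⟩)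
        (by simpa using ⟨hx, hxt.symm⟩) (by simpa using ⟨hy, hty⟩) hpq.ne
        (by rintro rfl; exact (hTN p hp).2.2 hvx) (by rintro rfl; exact (hTN q hq).2.2 hvx)
      rcases this with rfl | rfl | rfl <;> tauto
    have hxT : ∀ x, G.Adj v x → x ∉ T := fun x hvx hxT => (hTN x hxT).2.2 hvx
    have hab : a ≠ b := by
      rintro rfl
      exact (hout a ha x₁ hx₁ hv1 h1a x₂ hx₂ h2b.symm).elim (hxT x₂ hv2) h12.symm
    have hac : a ≠ c := by
      rintro rfl
      exact (hout a ha x₁ hx₁ hv1 h1a x₃ hx₃ h3c.symm).elim (hxT x₃ hv3) h13.symm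
    have hbc : b ≠ c := by
      rintro rfl
      exact (hout b hb x₂ hx₂ hv2 h2b x₃ hx₃ h3c.symm).elim (hxT x₃ hv3) h23.symm
    have hTabc : ∀ y ∈ T, y = a ∨ y = b ∨ y = c := fun y hy =>
      eq_of_card_le_three hT.2.1.le ha hb hc hy hab hac hbc
    refine hS.not_isMatchedTriangle hdeg3 (v := v) (x₁ := x₁) (x₂ := x₂) (x₃ := x₃) (a := a)
      (b := b) (c := c) ⟨⟨hv, hx₁, hx₂, hx₃, (hTN a ha).1, (hTN b hb).1, (hTN c hc).1⟩,
      ⟨h12, h13, h23⟩, ⟨hv1, hv2, hv3, h1a, h2b, h3c, hT.2.2.1 a ha b hb hab,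
        hT.2.2.1 a ha c hc hac, hT.2.2.1 b hb c hc hbc⟩,
      ⟨(hTN a ha).2.2, (hTN b hb).2.2, (hTN c hc).2.2⟩, ?_, ?_, ?_, ?_⟩
    · intro y hy hvy
      simpa [hNx] using (hmemN y).2 ⟨hy, hvy⟩
    · intro y hy hay
      have := hTabc y
      have := hout a ha x₁ hx₁ hv1 h1a y hy hay
      have := hay.ne'
      tauto
    · intro y hy hby
      have := hTabc y
      have := hout b hb x₂ hx₂ hv2 h2b y hy hby
      have := hby.ne'
      tauto
    · intro y hy hcy
      have := hTabc y
      have := hout c hc x₃ hx₃ hv3 h3c y hy hcy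
      have := hcy.ne'
      tauto

lemma hasSmallIsolatingSet (G : SimpleGraph V) (S : Finset V) : HasSmallIsolatingSet G S := by
  induction S using Finset.strongInduction with
  | H S ih =>
    by_contra hno
    have hS : IsIncompressible G S := by
      intro D X hX hne hc
      by_contra! hle
      obtain ⟨D', hD', hiso⟩ := ih (S \ X) (Finset.sdiff_ssubset hX hne)
      refine hno ⟨D ∪ D', ?_, fun U hUS hU hUa => ?_⟩
      · have h1 := Finset.card_union_le D D'
        have h2 := Finset.card_le_card hX
        rw [Finset.card_sdiff_of_subset hX] at hD'
        omega
      · have hdis := hc U hUS hU fun u hu d hd => hUa u hu d (Finset.mem_union_left _ hd)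
        exact hiso U (Finset.subset_sdiff.2 ⟨hUS, hdis⟩) hU
          fun u hu d hd => hUa u hu d (Finset.mem_union_right _ hd)
    refine hno ⟨∅, by simp, fun U hUS _ _ => ?_⟩
    rw [hS.eq_empty] at hUS
    exact Finset.subset_empty.1 hUS

/-- A graph with a cycle inside `W` has a nonempty core inside `W`. -/
lemma exists_core_of_not_isAcyclic {W : Set V} (h : ¬ (G.induce W).IsAcyclic) :
    ∃ U : Finset V, U.Nonempty ∧ IsCore G U ∧ ∀ u ∈ U, u ∈ W := by
  unfold SimpleGraph.IsAcyclic at h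
  push Not at h
  obtain ⟨v, c, hc⟩ := h
  refine ⟨c.support.toFinset.image Subtype.val, ⟨v, ?_⟩, ?_, ?_⟩
  · simp
  · intro u hu w
    simp only [Finset.mem_image, List.mem_toFinset] at hu
    obtain ⟨u, hu, rfl⟩ := hu
    have h2 := hc.ncard_neighborSet_toSubgraph_eq_two hu
    obtain ⟨x, y, hxy, he⟩ := Set.ncard_eq_two.1 h2
    have key : ∀ z ∈ c.toSubgraph.neighborSet u, (z : V) ∈ c.support.toFinset.image Subtype.val ∧
        G.Adj u z := by
      intro z hz
      have hz' : c.toSubgraph.Adj u z := hz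
      refine ⟨?_, hz'.adj_sub⟩
      simp only [Finset.mem_image, List.mem_toFinset]
      exact ⟨z, (SimpleGraph.Walk.mem_verts_toSubgraph c).1 hz'.snd_mem, rfl⟩
    have hx := key x (by simp [he])
    have hy := key y (by simp [he])
    by_cases hxw : (x : V) = w
    · exact ⟨y, hy.1, hy.2, fun e => hxy (Subtype.ext (hxw.trans e.symm))⟩
    · exact ⟨x, hx.1, hx.2, hxw⟩
  · intro u hu
    simp only [Finset.mem_image, List.mem_toFinset] at hu
    obtain ⟨u, -, rfl⟩ := hu
    exact u.2

/-- A connected graph with a triangle component is a triangle. -/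
lemma nonempty_iso_of_isTriangleComp [Fintype V] (hG : G.Connected) {T : Finset V}
    (hT : IsTriangleComp G Finset.univ T) : Nonempty (G ≃g cycleGraph 3) := by
  obtain ⟨a, ha⟩ := hT.nonempty
  have hall : ∀ b, b ∈ T := by
    intro b
    obtain ⟨p⟩ := hG.preconnected a b
    induction p with
    | nil => exact ha
    | cons h p ih => exact ih (hT.2.2.2 _ ha _ (Finset.mem_univ _) h)
  have hTu : T = Finset.univ := Finset.eq_univ_iff_forall.2 hall
  have hcard : Fintype.card V = 3 := by rw [← Finset.card_univ, ← hTu, hT.2.1]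
  have htop : G = ⊤ := by
    ext x y
    exact ⟨fun h => h.ne, fun h => hT.2.2.1 x (hall x) y (hall y) h⟩
  rw [htop, SimpleGraph.cycleGraph_three_eq_top]
  exact ⟨SimpleGraph.Iso.completeGraph (Fintype.equivFinOfCardEq hcard)⟩

end

/-- If `G` is a connected `n`-vertex graph that is not a triangle, then there is a set
`D ⊆ V(G)` with `|D| ≤ ⌊n/4⌋` such that `G − N[D]` contains no cycle. -/
theorem stmt17 {V : Type*} [Fintype V] (G : SimpleGraph V) (hG : G.Connected)
    (h : ¬ Nonempty (G ≃g cycleGraph 3)) :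
    ∃ D : Set V, D.ncard ≤ Fintype.card V / 4 ∧
      (G.induce (closedNbhd G D)ᶜ).IsAcyclic := by
  classical
  obtain ⟨D, hD, hiso⟩ := hasSmallIsolatingSet G Finset.univ
  have hno : triangleComps G Finset.univ = ∅ := Finset.eq_empty_of_forall_notMem fun T hT =>
    h (nonempty_iso_of_isTriangleComp hG (mem_triangleComps.1 hT))
  rw [hno, Finset.card_empty, add_zero, Finset.card_univ] at hD
  refine ⟨D, by rw [Set.ncard_coe_finset]; omega, ?_⟩
  by_contra hcyc
  obtain ⟨U, hne, hU, hUD⟩ := exists_core_of_not_isAcyclic hcyc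
  refine hne.ne_empty (hiso U (Finset.subset_univ U) hU fun u hu d hd => ⟨?_, fun hdu => ?_⟩)
  · rintro rfl
    exact hUD u hu (Or.inl hd)
  · exact hUD u hu (Or.inr ⟨d, hd, hdu⟩)
end
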